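/- arXiv:2310.05454 — 3 statements merged into one kernel-verified Lean document; each statement's English description precedes it below -/
import Mathlib

section
/- For every σ ∈ S* there exists a cylinder order ≤ on {0,1}^∞ with 0^∞ < 1^∞ such that m_≤ = σ(10^∞); and for every σ = (σ_n)_{n≥1} ∈ S^∞ there exists a cylinder order ≤ on {0,1}^∞ with 0^∞ < 1^∞ such that m_≤ = σ(1^∞) (the limit word lim_{n→∞} σ_{[1,n]}(1^∞)). -/
open scoped Classical

noncomputable section

/-- The ultrametric on infinite words: `d(a,b) = 2^{-min{n ≥ 1 : a_n ≠ b_n}}`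
(words are indexed from 0 here, so position `i` corresponds to `n = i+1`). -/
noncomputable def wdist {A : Type*} [DecidableEq A] (a b : ℕ → A) : ℝ :=
  if h : ∃ n, a n ≠ b n then (2 : ℝ)⁻¹ ^ (Nat.find h + 1) else 0

/-- The tail `a_{k+1} a_{k+2} ⋯` of an infinite word. -/
def shiftn {A : Type*} (a : ℕ → A) (k : ℕ) : ℕ → A := fun n => a (n + k)

/-- The set of tails of an infinite word (including the word itself). -/
def tails {A : Type*} (a : ℕ → A) : Set (ℕ → A) := {b | ∃ k, b = shiftn a k}

/-- A cylinder order: a total order such that `a ≤ b ≤ c` implies `d(a,b) ≤ d(a,c)`. -/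
def IsCylOrder {A : Type*} [DecidableEq A] (le : (ℕ → A) → (ℕ → A) → Prop) : Prop :=
  (∀ a b, le a b ∨ le b a) ∧
  (∀ a b, le a b → le b a → a = b) ∧
  (∀ a b c, le a b → le b c → le a c) ∧
  (∀ a b c, le a b → le b c → wdist a b ≤ wdist a c)

/-- Strict comparison associated to an order relation. -/
def wlt {A : Type*} (le : (ℕ → A) → (ℕ → A) → Prop) (a b : ℕ → A) : Prop :=
  le a b ∧ a ≠ b

/-- `m` is the least upper bound of the set `s` with respect to `le`. -/
def IsSupOf {A : Type*} (le : (ℕ → A) → (ℕ → A) → Prop) (s : Set (ℕ → A))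
    (m : ℕ → A) : Prop :=
  (∀ x ∈ s, le x m) ∧ ∀ b, (∀ x ∈ s, le x b) → le m b

/-- The set `M_≤ = {s_≤(a) : a ∈ A^∞}` of sup-words. -/
def supWords {A : Type*} (le : (ℕ → A) → (ℕ → A) → Prop) : Set (ℕ → A) :=
  {m | ∃ a, IsSupOf le (tails a) m}

/-- `x` is an accumulation point of `M` in the metric `wdist`. -/
def IsAccPt' {A : Type*} [DecidableEq A] (M : Set (ℕ → A)) (x : ℕ → A) : Prop :=
  ∀ ε : ℝ, 0 < ε → ∃ y ∈ M, y ≠ x ∧ wdist x y < ε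

/-- `x` is the smallest (w.r.t. `le`) accumulation point of `M`. -/
def IsSmallestAcc {A : Type*} [DecidableEq A] (le : (ℕ → A) → (ℕ → A) → Prop)
    (M : Set (ℕ → A)) (x : ℕ → A) : Prop :=
  IsAccPt' M x ∧ ∀ y, IsAccPt' M y → le x y

/-- Membership in the cylinder given by the finite word `w`. -/
def inCyl {A : Type*} (w : List A) (a : ℕ → A) : Prop :=
  ∀ i : Fin w.length, a i.val = w.get i

/-- `[u] < [v]` for cylinders: every element of `[u]` is strictly below every element of `[v]`. -/
def cylLt {A : Type*} (le : (ℕ → A) → (ℕ → A) → Prop) (u v : List A) : Prop :=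
  ∀ a b, inCyl u a → inCyl v b → wlt le a b

/-- Infinite binary words. -/
abbrev W2 := ℕ → Bool

/-- The word `0^∞`. -/
def w0 : W2 := fun _ => false

/-- The word `1^∞`. -/
def w1 : W2 := fun _ => true

/-- The word `10^∞`. -/
def w10inf : W2 := fun n => decide (n = 0)

/-- The periodic word `w^∞` for a finite word `w`. -/
def perW (w : List Bool) : W2 := fun n => w.getD (n % w.length) false

/-- A substitution on `{0,1}`, given by the images of the two letters. -/
abbrev Sub2 := Bool → List Bool

/-- Action of a substitution on finite words. -/
def listApply (f : Sub2) (l : List Bool) : List Bool := (l.map f).flatten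

/-- Action of a (nonerasing) substitution on infinite words. -/
def subApply (f : Sub2) (a : W2) : W2 :=
  fun n => (listApply f (List.ofFn (fun i : Fin (n + 1) => a i.val))).getD n false

/-- The substitution `τ_{j,k} : 0 ↦ 10^j, 1 ↦ 10^k`. -/
def tauS (j k : ℕ) : Sub2 := fun b => true :: List.replicate (if b then k else j) false

/-- Membership in the set `S = {τ_{j,k} : 0 ≤ j < k}`. -/
def memS (f : Sub2) : Prop := ∃ j k : ℕ, j < k ∧ f = tauS j k

/-- Apply a finite composition `σ_1 ∘ ⋯ ∘ σ_n` (given as a list) to an infinite word. -/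
def applyList (L : List Sub2) (a : W2) : W2 := L.foldr subApply a

/-- Apply a finite composition `σ_1 ∘ ⋯ ∘ σ_n` (given as a list) to a finite word. -/
def listApplyL (L : List Sub2) (l : List Bool) : List Bool := L.foldr listApply l

/-- `σ_{[1,n]} = σ_1 ∘ ⋯ ∘ σ_n` applied to an infinite word, for `σ ∈ S^∞`
(indexed from 0 in Lean). -/
def compUpTo (σ : ℕ → Sub2) (n : ℕ) (a : W2) : W2 :=
  applyList (List.ofFn (fun i : Fin n => σ i.val)) a

/-- `m` is the limit word `lim_{n → ∞} σ_{[1,n]}(a)`. -/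
def IsLimitWord (σ : ℕ → Sub2) (a m : W2) : Prop :=
  ∀ ε : ℝ, 0 < ε → ∃ N : ℕ, ∀ n ≥ N, wdist (compUpTo σ n a) m < ε

namespace CylinderWords

/-! ### Prefixes and tails of infinite words -/

/-- The words `a` and `b` have the same prefix of length `n`. -/
def Agree (n : ℕ) (a b : W2) : Prop := ∀ i < n, a i = b i

/-- The prefix of length `n` of `a`. -/
def pre (a : W2) (n : ℕ) : List Bool := List.ofFn (fun i : Fin n => a i.val)

/-- The infinite word obtained by putting the finite word `l` in front of `x`. -/
def cat (l : List Bool) (x : W2) : W2 :=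
  fun n => if n < l.length then l.getD n false else x (n - l.length)

theorem Agree.symm {n : ℕ} {a b : W2} (h : Agree n a b) : Agree n b a :=
  fun i hi => (h i hi).symm

theorem Agree.trans {n : ℕ} {a b c : W2} (h : Agree n a b) (h' : Agree n b c) : Agree n a c :=
  fun i hi => (h i hi).trans (h' i hi)

theorem Agree.mono {m n : ℕ} {a b : W2} (h : Agree n a b) (hmn : m ≤ n) : Agree m a b :=
  fun i hi => h i (hi.trans_le hmn)

theorem eq_of_forall_agree {a b : W2} (h : ∀ n, Agree n a b) : a = b :=
  funext fun n => h (n + 1) n n.lt_succ_self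

@[simp] theorem shiftn_apply (a : W2) (k n : ℕ) : shiftn a k n = a (n + k) := rfl

@[simp] theorem shiftn_zero (a : W2) : shiftn a 0 = a := rfl

theorem shiftn_shiftn (a : W2) (k l : ℕ) : shiftn (shiftn a k) l = shiftn a (k + l) := by
  funext n; simp only [shiftn_apply]; congr 1; omega

@[simp] theorem length_pre (a : W2) (n : ℕ) : (pre a n).length = n := by simp [pre]

theorem pre_eq_pre_iff {a b : W2} {n : ℕ} : pre a n = pre b n ↔ Agree n a b := by
  simp only [pre, List.ofFn_inj, Agree]
  exact ⟨fun h i hi => congrFun h ⟨i, hi⟩, fun h => funext fun i => h i.1 i.2⟩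

theorem Agree.pre_eq {a b : W2} {n : ℕ} (h : Agree n a b) : pre a n = pre b n :=
  pre_eq_pre_iff.2 h

theorem pre_succ (a : W2) (n : ℕ) : pre a (n + 1) = a 0 :: pre (shiftn a 1) n := by
  simp [pre, List.ofFn_succ]

theorem pre_succ' (a : W2) (n : ℕ) : pre a (n + 1) = pre a n ++ [a n] := by
  rw [pre, List.ofFn_succ', List.concat_eq_append]
  rfl

theorem pre_append (a : W2) (n m : ℕ) : pre a (n + m) = pre a n ++ pre (shiftn a n) m := by
  induction m with
  | zero => simp [pre]
  | succ m ih => rw [← add_assoc, pre_succ', pre_succ', ih, List.append_assoc, shiftn_apply,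
      add_comm m n]

theorem cat_apply_lt {l : List Bool} (x : W2) {n : ℕ} (h : n < l.length) :
    cat l x n = l.getD n false := if_pos h

@[simp] theorem cat_apply_add (l : List Bool) (x : W2) (n : ℕ) : cat l x (n + l.length) = x n := by
  simp [cat]

theorem cat_apply_length (l : List Bool) (x : W2) : cat l x l.length = x 0 := by
  simp [cat]

theorem cat_append (l l' : List Bool) (x : W2) : cat (l ++ l') x = cat l (cat l' x) := by
  funext n
  simp only [cat, List.length_append]
  split_ifs with h1 h2 h3 h3
  · exact List.getD_append _ _ _ _ h2
  · rw [List.getD_append_right _ _ _ _ (by omega)]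
  · omega
  · omega
  · omega
  · congr 1; omega

theorem shiftn_cat (l : List Bool) (x : W2) : shiftn (cat l x) l.length = x := by
  funext n; simp

theorem pre_cat (l : List Bool) (x : W2) : pre (cat l x) l.length = l := by
  refine List.ext_getElem (by simp) fun i _ _ => ?_
  simp [pre, cat]

theorem agree_cat {n : ℕ} (l : List Bool) {x y : W2} (h : Agree n x y) :
    Agree (n + l.length) (cat l x) (cat l y) := by
  intro i hi
  simp only [cat]
  split_ifs with hl
  · rfl
  · exact h _ (by omega)

theorem exists_first_diff {a b : W2} (h : a ≠ b) : ∃ n, Agree n a b ∧ a n ≠ b n := by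
  have hex : ∃ n, a n ≠ b n := Function.ne_iff.1 h
  exact ⟨Nat.find hex, fun i hi => not_not.1 (Nat.find_min hex hi), Nat.find_spec hex⟩

/-- A rule prescribing each letter in terms of the preceding prefix is satisfied by some word. -/
theorem exists_word (c : List Bool → Bool) : ∃ m : W2, ∀ n, m n = c (pre m n) := by
  let g : ℕ → List Bool := fun n => Nat.rec [] (fun _ w => w ++ [c w]) n
  refine ⟨fun n => c (g n), fun n => ?_⟩
  have : ∀ n, pre (fun n => c (g n)) n = g n := by
    intro n
    induction n with
    | zero => simp [pre, g]
    | succ n ih => rw [pre_succ', ih]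
  rw [this]

/-! ### The metric -/

theorem wdist_le_iff {a b : W2} {n : ℕ} :
    wdist a b ≤ (2 : ℝ)⁻¹ ^ (n + 1) ↔ Agree n a b := by
  unfold wdist
  split_ifs with h
  · rw [pow_le_pow_iff_right_of_lt_one₀ (by norm_num) (by norm_num)]
    rw [add_le_add_iff_right, Nat.le_find_iff]
    simp [Agree]
  · push Not at h
    exact ⟨fun _ i _ => h i, fun _ => by positivity⟩

theorem exists_pow_lt {ε : ℝ} (hε : 0 < ε) : ∃ n : ℕ, (2 : ℝ)⁻¹ ^ (n + 1) < ε := by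
  obtain ⟨n, hn⟩ := exists_pow_lt_of_lt_one hε (by norm_num : (2 : ℝ)⁻¹ < 1)
  exact ⟨n, (pow_le_pow_of_le_one (by norm_num) (by norm_num) n.le_succ).trans_lt hn⟩

theorem isAccPt'_iff {M : Set W2} {x : W2} :
    IsAccPt' M x ↔ ∀ n, ∃ y ∈ M, y ≠ x ∧ Agree n x y := by
  constructor
  · intro h n
    obtain ⟨y, hy, hne, hd⟩ := h ((2 : ℝ)⁻¹ ^ (n + 1)) (by positivity)
    exact ⟨y, hy, hne, wdist_le_iff.1 hd.le⟩
  · intro h ε hε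
    obtain ⟨n, hn⟩ := exists_pow_lt hε
    obtain ⟨y, hy, hne, ha⟩ := h n
    exact ⟨y, hy, hne, (wdist_le_iff.2 ha).trans_lt hn⟩

/-! ### Cylinder orders given by orientations of the binary tree -/

/-- The strict order in which `o w` is the larger of the two letters that may follow the
common prefix `w`. -/
def olt (o : List Bool → Bool) (a b : W2) : Prop :=
  ∃ n, Agree n a b ∧ a n = !o (pre a n) ∧ b n = o (pre a n)

/-- The reflexive closure of `olt o`. -/
def ole (o : List Bool → Bool) (a b : W2) : Prop := a = b ∨ olt o a b

section Order

variable {o : List Bool → Bool} {a b c : W2}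

theorem olt_or_olt (h : a ≠ b) : olt o a b ∨ olt o b a := by
  obtain ⟨n, hn, hne⟩ := exists_first_diff h
  by_cases hb : b n = o (pre a n)
  · refine Or.inl ⟨n, hn, ?_, hb⟩
    rw [← hb]; exact Bool.eq_not_of_ne hne
  · refine Or.inr ⟨n, hn.symm, ?_, ?_⟩ <;> rw [← hn.pre_eq]
    · exact Bool.eq_not_of_ne hb
    · rw [Bool.eq_not_of_ne hb] at hne
      simpa using hne

theorem olt_asymm (h : olt o a b) : ¬ olt o b a := by
  obtain ⟨n, hn, ha, hb⟩ := h
  rintro ⟨m, hm, hb', ha'⟩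
  have hna : a n ≠ b n := by rw [ha, hb]; simp
  have hma : b m ≠ a m := by rw [ha', hb']; simp
  obtain h | rfl | h := lt_trichotomy n m
  · exact hna (hm n h).symm
  · rw [← hn.pre_eq, ← ha] at hb'
    exact hna hb'.symm
  · exact hma (hn m h).symm

theorem olt_irrefl : ¬ olt o a a := fun h => olt_asymm h h

theorem olt_trans (h : olt o a b) (h' : olt o b c) : olt o a c := by
  obtain ⟨n, hn, ha, hb⟩ := h
  obtain ⟨m, hm, hb', hc⟩ := h'
  obtain h | rfl | h := lt_trichotomy n m
  · exact ⟨n, hn.trans (hm.mono h.le), ha, hm n h ▸ hb⟩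
  · rw [hn.pre_eq, hb'] at hb
    simp at hb
  · have e := (hn.mono h.le).pre_eq
    exact ⟨m, (hn.mono h.le).trans hm, by rw [hn m h, hb', e], by rw [hc, e]⟩

theorem olt_or_ole (o : List Bool → Bool) (a b : W2) : olt o a b ∨ ole o b a := by
  by_cases h : a = b
  · exact Or.inr (Or.inl h.symm)
  · exact (olt_or_olt h).imp_right Or.inr

theorem ole_antisymm (h : ole o a b) (h' : ole o b a) : a = b := by
  rcases h with h | h
  · exact h
  · rcases h' with h' | h'
    · exact h'.symm
    · exact (olt_asymm h h').elim

theorem not_ole_of_olt (h : olt o a b) : ¬ ole o b a := by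
  rintro (rfl | h')
  · exact olt_irrefl h
  · exact olt_asymm h h'

theorem ole_trans (hab : ole o a b) (hbc : ole o b c) : ole o a c := by
  rcases hab with rfl | hab
  · exact hbc
  · rcases hbc with rfl | hbc
    · exact Or.inr hab
    · exact Or.inr (olt_trans hab hbc)

/-- Intervals with end points in a cylinder stay in this cylinder. -/
theorem agree_of_ole {n : ℕ} (h : ole o a b) (h' : ole o b c) (hac : Agree n a c) :
    Agree n a b := by
  rcases h with rfl | ⟨m, hm, ha, hb⟩
  · exact fun _ _ => rfl
  by_contra hcon
  have hmn : m < n := by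
    by_contra hle
    exact hcon (hm.mono (not_lt.1 hle))
  refine not_ole_of_olt ⟨m, (hac.mono hmn.le).symm.trans hm, ?_, ?_⟩ h'
  · rw [← hac m hmn, ← (hac.mono hmn.le).pre_eq, ha]
  · rw [← (hac.mono hmn.le).pre_eq, hb]

theorem isCylOrder_ole (o : List Bool → Bool) : IsCylOrder (ole o) := by
  refine ⟨fun a b => ?_, fun a b => ole_antisymm, fun a b c => ole_trans, fun a b c h h' => ?_⟩
  · exact (olt_or_ole o a b).imp_left Or.inr
  · by_cases hac : a = c
    · subst hac
      rw [ole_antisymm h h']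
    · obtain ⟨n, hn, hne⟩ := exists_first_diff hac
      have hd : ¬ wdist a c ≤ (2 : ℝ)⁻¹ ^ (n + 1 + 1) :=
        fun hle => hne (wdist_le_iff.1 hle n n.lt_succ_self)
      have hex : ∃ i, a i ≠ c i := ⟨n, hne⟩
      have hfind : Nat.find hex = n :=
        (Nat.find_eq_iff hex).2 ⟨hne, fun i hi => not_not.2 (hn i hi)⟩
      have hac' : wdist a c = (2 : ℝ)⁻¹ ^ (n + 1) := by
        rw [wdist, dif_pos hex, hfind]
      rw [hac']
      exact wdist_le_iff.2 (agree_of_ole h h' hn)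

theorem olt_of_zero (ho : o [] = true) (ha : a 0 = false) (hb : b 0 = true) : olt o a b :=
  ⟨0, fun _ hi => absurd hi (Nat.not_lt_zero _), by simp [pre, ho, ha], by simp [pre, ho, hb]⟩

theorem zero_eq_true_of_ole (ho : o [] = true) (h : ole o a b) (ha : a 0 = true) :
    b 0 = true := by
  by_contra hb
  exact not_ole_of_olt (olt_of_zero ho (by simpa using hb) ha) h

theorem wlt_ole_w0_w1 (ho : o [] = true) : wlt (ole o) w0 w1 :=
  ⟨Or.inr (olt_of_zero ho rfl rfl), fun h => by simpa [w0, w1] using congrFun h 0⟩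

theorem olt_cat {x y : W2} (v : List Bool) (hx : x 0 = !o v) (hy : y 0 = o v) :
    olt o (cat v x) (cat v y) := by
  refine ⟨v.length, fun i hi => ?_, ?_, ?_⟩
  · rw [cat_apply_lt x hi, cat_apply_lt y hi]
  · rw [pre_cat, cat_apply_length, hx]
  · rw [pre_cat, cat_apply_length, hy]

end Order

/-! ### Suprema of tails -/

/-- `x` is the maximum of the closure of the set of tails of `a`. -/
def IsTailMax (o : List Bool → Bool) (a x : W2) : Prop :=
  (∀ k, ole o (shiftn a k) x) ∧ ∀ n, ∃ k, Agree n (shiftn a k) x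

theorem IsTailMax.isSupOf {o : List Bool → Bool} {a x : W2} (h : IsTailMax o a x) :
    IsSupOf (ole o) (tails a) x := by
  refine ⟨?_, fun b hb => ?_⟩
  · rintro _ ⟨k, rfl⟩
    exact h.1 k
  · refine (olt_or_ole o b x).resolve_left ?_
    rintro ⟨n, hn, hbn, hxn⟩
    obtain ⟨k, hk⟩ := h.2 (n + 1)
    refine not_ole_of_olt ⟨n, hn.trans (hk.mono n.le_succ).symm, hbn, ?_⟩ (hb _ ⟨k, rfl⟩)
    rw [hk n n.lt_succ_self, hxn]

theorem exists_isTailMax (o : List Bool → Bool) (a : W2) : ∃ x, IsTailMax o a x := by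
  obtain ⟨m, hm⟩ := exists_word fun w =>
    if ∃ k, pre (shiftn a k) (w.length + 1) = w ++ [o w] then o w else !o w
  simp only [length_pre] at hm
  refine ⟨m, fun k => ?_, fun n => ?_⟩
  · refine (olt_or_ole o m (shiftn a k)).resolve_left ?_
    rintro ⟨n, hn, hmn, hkn⟩
    have : ∃ k, pre (shiftn a k) (n + 1) = pre m n ++ [o (pre m n)] :=
      ⟨k, by rw [pre_succ', ← hn.pre_eq, hkn]⟩
    have h := hm n
    rw [if_pos this, hmn] at h
    simp at h
  · induction n with
    | zero => exact ⟨0, fun _ hi => absurd hi (Nat.not_lt_zero _)⟩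
    | succ n ih =>
      by_cases hex : ∃ k, pre (shiftn a k) (n + 1) = pre m n ++ [o (pre m n)]
      · have h := hm n
        rw [if_pos hex] at h
        obtain ⟨k, hk⟩ := hex
        exact ⟨k, pre_eq_pre_iff.1 (by rw [hk, pre_succ', h])⟩
      · have h := hm n
        rw [if_neg hex] at h
        obtain ⟨k, hk⟩ := ih
        refine ⟨k, pre_eq_pre_iff.1 ?_⟩
        rw [pre_succ', pre_succ', hk.pre_eq, h]
        congr 2
        refine Bool.eq_not_of_ne fun hk' => hex ⟨k, ?_⟩
        rw [pre_succ', hk.pre_eq, hk']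

theorem isSupOf_unique {o : List Bool → Bool} {s : Set W2} {x y : W2}
    (hx : IsSupOf (ole o) s x) (hy : IsSupOf (ole o) s y) : x = y :=
  ole_antisymm (hx.2 y hy.1) (hy.2 x hx.1)

theorem mem_supWords_iff {o : List Bool → Bool} {x : W2} :
    x ∈ supWords (ole o) ↔ ∃ a, IsTailMax o a x := by
  constructor
  · rintro ⟨a, ha⟩
    obtain ⟨y, hy⟩ := exists_isTailMax o a
    exact ⟨a, isSupOf_unique hy.isSupOf ha ▸ hy⟩
  · rintro ⟨a, ha⟩
    exact ⟨a, ha.isSupOf⟩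

theorem IsTailMax.unique {o : List Bool → Bool} {a x y : W2} (hx : IsTailMax o a x)
    (hy : IsTailMax o a y) : x = y :=
  isSupOf_unique hx.isSupOf hy.isSupOf

theorem w1_mem_supWords (o : List Bool → Bool) : w1 ∈ supWords (ole o) :=
  mem_supWords_iff.2 ⟨w1, fun _ => Or.inl rfl, fun _ => ⟨0, fun _ _ => rfl⟩⟩

theorem w10inf_mem_supWords {o : List Bool → Bool} (ho : o [] = true) :
    w10inf ∈ supWords (ole o) := by
  refine mem_supWords_iff.2 ⟨w10inf, fun k => ?_, fun _ => ⟨0, fun _ _ => rfl⟩⟩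
  cases k with
  | zero => exact Or.inl rfl
  | succ k => exact Or.inr (olt_of_zero ho (by simp [w10inf]) rfl)

/-- The only sup-word starting with `0` is `0^∞`. -/
theorem IsTailMax.eq_w0 {o : List Bool → Bool} (ho : o [] = true) {a x : W2}
    (h : IsTailMax o a x) (hx : x 0 = false) : x = w0 := by
  have ha : ∀ k, a k = false := by
    intro k
    by_contra hk
    have := zero_eq_true_of_ole ho (h.1 k) (by simpa using hk)
    simp [hx] at this
  funext n
  obtain ⟨k, hk⟩ := h.2 (n + 1)
  rw [← hk n n.lt_succ_self]
  exact ha _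

theorem zero_eq_true_of_isAccPt' {o : List Bool → Bool} (ho : o [] = true) {y : W2}
    (hy : IsAccPt' (supWords (ole o)) y) : y 0 = true := by
  rw [isAccPt'_iff] at hy
  by_contra h
  have h0 : y 0 = false := by simpa using h
  have key : ∀ n, Agree (n + 1) y w0 := by
    intro n
    obtain ⟨z, hz, -, ha⟩ := hy (n + 1)
    obtain ⟨b, hb⟩ := mem_supWords_iff.1 hz
    rwa [hb.eq_w0 ho (by rw [← ha 0 n.succ_pos, h0])] at ha
  have hyw : y = w0 := eq_of_forall_agree fun n => (key n).mono n.le_succ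
  obtain ⟨z, hz, hne, ha⟩ := hy 1
  obtain ⟨b, hb⟩ := mem_supWords_iff.1 hz
  exact hne ((hb.eq_w0 ho (by rw [← ha 0 one_pos, h0])).trans hyw.symm)

/-! ### The substitutions `τ_{j,k}` -/

section Substitution

variable {j k : ℕ}

theorem listApply_cons (f : Sub2) (b : Bool) (w : List Bool) :
    listApply f (b :: w) = f b ++ listApply f w := by simp [listApply]

theorem listApply_append (f : Sub2) (w w' : List Bool) :
    listApply f (w ++ w') = listApply f w ++ listApply f w' := by simp [listApply]

@[simp] theorem length_tauS (j k : ℕ) (b : Bool) :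
    (tauS j k b).length = (if b then k else j) + 1 := by simp [tauS]

theorem length_le_length_listApply (j k : ℕ) (w : List Bool) :
    w.length ≤ (listApply (tauS j k) w).length := by
  induction w with
  | nil => simp
  | cons b w ih => rw [listApply_cons, List.length_append, length_tauS, List.length_cons]; omega

theorem listApply_eq_replicate_append {n : ℕ} {w w' : List Bool}
    (h : listApply (tauS j k) w = List.replicate (n + 1) false ++ w') : False := by
  cases w with
  | nil => simp [listApply, List.replicate_succ] at h
  | cons b w => simp [listApply_cons, tauS, List.replicate_succ] at h

theorem listApply_injective (hjk : j < k) : Function.Injective (listApply (tauS j k)) := by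
  have hk : List.replicate k false = List.replicate j false ++
      List.replicate (k - j - 1 + 1) false := by
    rw [List.replicate_append_replicate]; congr 1; omega
  intro w
  induction w with
  | nil =>
    intro w' h
    cases w' with
    | nil => rfl
    | cons b w' => simp [listApply, tauS] at h
  | cons b w ih =>
    intro w' h
    cases w' with
    | nil => simp [listApply, tauS] at h
    | cons c w' =>
      rw [listApply_cons, listApply_cons] at h
      cases b <;> cases c
      · rw [ih (List.append_cancel_left h)]
      · simp only [tauS, if_true, Bool.false_eq_true, if_false, hk, List.cons_append,
          List.cons.injEq, true_and, List.append_assoc] at h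
        exact (listApply_eq_replicate_append (List.append_cancel_left h)).elim
      · simp only [tauS, if_true, Bool.false_eq_true, if_false, hk, List.cons_append,
          List.cons.injEq, true_and, List.append_assoc] at h
        exact (listApply_eq_replicate_append (List.append_cancel_left h).symm).elim
      · rw [ih (List.append_cancel_left h)]

theorem subApply_eq_getD (j k : ℕ) (a : W2) {n m : ℕ} (h : n < m) :
    subApply (tauS j k) a n = (listApply (tauS j k) (pre a m)).getD n false := by
  obtain ⟨d, rfl⟩ := Nat.exists_eq_add_of_le (Nat.succ_le_of_lt h)
  rw [pre_append, listApply_append, List.getD_append _ _ _ _ (lt_of_lt_of_le n.lt_succ_self _)]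
  · rfl
  · simpa using length_le_length_listApply j k (pre a (n + 1))

theorem subApply_eq_cat_one (j k : ℕ) (a : W2) :
    subApply (tauS j k) a = cat (tauS j k (a 0)) (subApply (tauS j k) (shiftn a 1)) := by
  funext n
  rw [subApply_eq_getD j k a (Nat.lt_succ_self n), pre_succ, listApply_cons]
  simp only [cat]
  split_ifs with h
  · exact List.getD_append _ _ _ _ h
  · rw [List.getD_append_right _ _ _ _ (not_lt.1 h), subApply_eq_getD j k (shiftn a 1) (m := n)]
    simp only [length_tauS] at h ⊢
    omega

theorem subApply_eq_cat (j k : ℕ) (a : W2) (n : ℕ) :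
    subApply (tauS j k) a =
      cat (listApply (tauS j k) (pre a n)) (subApply (tauS j k) (shiftn a n)) := by
  induction n with
  | zero => funext i; simp [pre, cat, listApply]
  | succ n ih =>
    rw [ih, subApply_eq_cat_one j k (shiftn a n), shiftn_shiftn, ← cat_append, pre_succ',
      listApply_append]
    simp [listApply]

theorem subApply_zero (j k : ℕ) (a : W2) : subApply (tauS j k) a 0 = true := by
  rw [subApply_eq_cat_one, cat_apply_lt _ (by simp)]
  simp [tauS]

theorem agree_subApply_succ {n : ℕ} {a b : W2} (h : Agree n a b) :
    Agree (n + 1) (subApply (tauS j k) a) (subApply (tauS j k) b) := by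
  rw [subApply_eq_cat j k a n, subApply_eq_cat j k b n, h.pre_eq]
  refine (agree_cat _ (n := 1) ?_).mono ?_
  · intro i hi
    obtain rfl : i = 0 := by omega
    rw [subApply_zero, subApply_zero]
  · have := length_le_length_listApply j k (pre b n)
    rw [length_pre] at this
    omega

theorem subApply_apply_of_le (j k : ℕ) (a : W2) {n : ℕ} (h1 : 1 ≤ n)
    (h : n ≤ if a 0 then k else j) : subApply (tauS j k) a n = false := by
  rw [subApply_eq_cat_one, cat_apply_lt _ (by rw [length_tauS]; omega)]
  obtain ⟨n, rfl⟩ := Nat.exists_eq_add_of_le' h1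
  simp only [tauS, List.getD_cons_succ]
  simp

theorem subApply_apply_add (j k : ℕ) (a : W2) (n : ℕ) :
    subApply (tauS j k) a (n + ((if a 0 then k else j) + 1)) =
      subApply (tauS j k) (shiftn a 1) n := by
  rw [subApply_eq_cat_one, ← length_tauS j k, cat_apply_add]

theorem subApply_apply_succ_left (hjk : j < k) (a : W2) :
    subApply (tauS j k) a (j + 1) = !a 0 := by
  cases h : a 0
  · have := subApply_apply_add j k a 0
    simp only [h, Bool.false_eq_true, if_false, zero_add] at this
    rw [this, subApply_zero]; rfl
  · rw [subApply_apply_of_le j k a (by omega) (by simp [h]; omega)]; rfl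

theorem agree_of_agree_subApply (hjk : j < k) {n : ℕ} {a b : W2}
    (h : Agree (n * (k + 1) + 1) (subApply (tauS j k) a) (subApply (tauS j k) b)) :
    Agree n a b := by
  induction n generalizing a b with
  | zero => exact fun _ hi => absurd hi (Nat.not_lt_zero _)
  | succ n ih =>
    have h0 : a 0 = b 0 := by
      have := h (j + 1) (by nlinarith)
      rw [subApply_apply_succ_left hjk, subApply_apply_succ_left hjk] at this
      simpa using this
    have hs : Agree n (shiftn a 1) (shiftn b 1) := by
      refine ih fun i hi => ?_
      rw [← subApply_apply_add, ← subApply_apply_add, ← h0]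
      refine h _ ?_
      have : (if a 0 then k else j) ≤ k := by split_ifs <;> omega
      nlinarith
    intro i hi
    cases i with
    | zero => exact h0
    | succ i => exact hs i (by omega)

theorem subApply_injective (hjk : j < k) : Function.Injective (subApply (tauS j k)) :=
  fun _ _ h => eq_of_forall_agree fun _ => agree_of_agree_subApply hjk fun _ _ => by rw [h]

theorem shiftn_subApply (j k : ℕ) (a : W2) (p : ℕ) :
    subApply (tauS j k) a p = false ∨
      ∃ q, shiftn (subApply (tauS j k) a) p = subApply (tauS j k) (shiftn a q) := by
  induction p using Nat.strong_induction_on generalizing a with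
  | _ p ih =>
    by_cases h0 : p = 0
    · subst h0
      exact Or.inr ⟨0, rfl⟩
    by_cases hp : p ≤ if a 0 then k else j
    · exact Or.inl (subApply_apply_of_le j k a (by omega) hp)
    · obtain ⟨d, rfl⟩ := Nat.exists_eq_add_of_le' (Nat.succ_le_of_lt (not_le.1 hp))
      rw [Nat.succ_eq_add_one, subApply_apply_add]
      refine (ih d (by omega) (shiftn a 1)).imp_right ?_
      rintro ⟨q, hq⟩
      refine ⟨1 + q, ?_⟩
      rw [← shiftn_shiftn a, ← hq]
      funext n
      rw [shiftn_apply, shiftn_apply, ← add_assoc, subApply_apply_add]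

theorem exists_shiftn_subApply (j k : ℕ) (a : W2) (q : ℕ) :
    ∃ p, shiftn (subApply (tauS j k) a) p = subApply (tauS j k) (shiftn a q) := by
  rw [subApply_eq_cat j k a q]
  exact ⟨_, shiftn_cat _ _⟩

/-- The word `a` starts with `10^j1` or `10^k1`. -/
def IsBlock (j k : ℕ) (a : W2) : Prop :=
  a 0 = true ∧ ∃ i, (i = j ∨ i = k) ∧ (∀ p, 1 ≤ p → p ≤ i → a p = false) ∧ a (i + 1) = true

theorem isBlock_subApply (j k : ℕ) (a : W2) : IsBlock j k (subApply (tauS j k) a) := by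
  refine ⟨subApply_zero j k a, if a 0 then k else j, ?_, fun p => subApply_apply_of_le j k a, ?_⟩
  · split_ifs <;> simp
  · have := subApply_apply_add j k a 0
    rwa [zero_add, subApply_zero] at this

theorem IsBlock.congr (hjk : j < k) {a b : W2} (ha : IsBlock j k a) (h : Agree (k + 2) a b) :
    IsBlock j k b := by
  obtain ⟨h0, i, hi, hp, h1⟩ := ha
  have hik : i ≤ k := by omega
  refine ⟨by rw [← h 0 (by omega), h0], i, hi, fun p hp1 hpi => ?_, ?_⟩
  · rw [← h p (by omega), hp p hp1 hpi]
  · rw [← h _ (by omega), h1]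

/-- Removal of the first block `10^j` or `10^k`. -/
def advance (j k : ℕ) (a : W2) : W2 := shiftn a ((if a (j + 1) then j else k) + 1)

/-- The word whose image under `τ_{j,k}` is `a`, for concatenations `a` of blocks. -/
def decode (j k : ℕ) (a : W2) : W2 := fun n => !((advance j k)^[n] a) (j + 1)

theorem subApply_decode (hjk : j < k) {a : W2} (h0 : a 0 = true)
    (h : ∀ p, a p = true → IsBlock j k (shiftn a p)) :
    subApply (tauS j k) (decode j k a) = a := by
  refine eq_of_forall_agree fun n => ?_
  induction n generalizing a with
  | zero => exact fun _ hi => absurd hi (Nat.not_lt_zero _)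
  | succ n ih =>
    obtain ⟨-, i, hi, hp, h1⟩ := h 0 h0
    rw [shiftn_zero] at hp h1
    have hij : (if a (j + 1) then j else k) = i := by
      rcases hi with rfl | rfl
      · rw [if_pos h1]
      · rw [hp (j + 1) (by omega) (by omega)]; simp
    have hadv : advance j k a = shiftn a (i + 1) := by rw [advance, hij]
    have hd0 : (if decode j k a 0 then k else j) = i := by
      rw [← hij]
      show (if !a (j + 1) then k else j) = _
      cases a (j + 1) <;> rfl
    have hds : shiftn (decode j k a) 1 = decode j k (shiftn a (i + 1)) := by
      rw [← hadv]; rfl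
    have ih' := @ih (shiftn a (i + 1)) (by simpa using h1) fun p hpt => by
      rw [shiftn_shiftn]
      exact h _ (by rwa [shiftn_apply, add_comm] at hpt)
    intro m hm
    by_cases hm0 : m = 0
    · rw [hm0, subApply_zero, h0]
    by_cases hmi : m ≤ i
    · rw [hp m (by omega) hmi, subApply_apply_of_le j k _ (by omega) (by omega)]
    · obtain ⟨d, rfl⟩ := Nat.exists_eq_add_of_le' (Nat.succ_le_of_lt (not_le.1 hmi))
      have := subApply_apply_add j k (decode j k a) d
      rw [hd0] at this
      rw [Nat.succ_eq_add_one, this, hds, ih' d (by omega), shiftn_apply]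

end Substitution

/-! ### Transporting orientations along a substitution -/

/-- The orientation making `f = τ_{j,k}` an order embedding and the words starting with
`10^j1` or `10^k1` the smallest ones starting with `1`. -/
def transport (f : Sub2) (o : List Bool → Bool) (v : List Bool) : Bool :=
  if h : ∃ w, v = listApply f w ++ f false then !o h.choose else decide (v ≠ f true)

section Transport

variable {j k : ℕ} {o : List Bool → Bool}

theorem transport_listApply (hjk : j < k) (o : List Bool → Bool) (w : List Bool) :
    transport (tauS j k) o (listApply (tauS j k) w ++ tauS j k false) = !o w := by
  have h : ∃ w', listApply (tauS j k) w ++ tauS j k false =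
      listApply (tauS j k) w' ++ tauS j k false := ⟨w, rfl⟩
  rw [transport, dif_pos h,
    ← listApply_injective hjk (List.append_cancel_right h.choose_spec)]

theorem transport_nil (j k : ℕ) (o : List Bool → Bool) : transport (tauS j k) o [] = true := by
  have h : ¬ ∃ w, [] = listApply (tauS j k) w ++ tauS j k false := by simp [tauS]
  rw [transport, dif_neg h]
  simp [tauS]

theorem transport_block_of_ne {p : ℕ} (hp : p ≠ j) (o : List Bool → Bool) :
    transport (tauS j k) o (true :: List.replicate p false) = decide (p ≠ k) := by
  have h : ¬ ∃ w, true :: List.replicate p false =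
      listApply (tauS j k) w ++ tauS j k false := by
    rintro ⟨w, hw⟩
    cases w with
    | nil =>
      have := congrArg List.length hw
      simp [listApply] at this
      exact hp this
    | cons b w =>
      rw [listApply_cons] at hw
      have := congrArg (List.count true) hw
      simp [tauS, List.count_replicate] at this
  rw [transport, dif_neg h]
  simp [tauS]

theorem transport_block_self (hjk : j < k) (o : List Bool → Bool) :
    transport (tauS j k) o (true :: List.replicate j false) = !o [] := by
  simpa [listApply, tauS] using transport_listApply hjk o []

theorem olt_subApply (hjk : j < k) {a b : W2} (h : olt o a b) :
    olt (transport (tauS j k) o) (subApply (tauS j k) a) (subApply (tauS j k) b) := by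
  have hfalse : ∀ (x : W2) (n : ℕ), x n = false → ∃ y : W2, y 0 = true ∧ subApply (tauS j k) x =
      cat (listApply (tauS j k) (pre x n) ++ tauS j k false) y := by
    intro x n hx
    refine ⟨subApply (tauS j k) (shiftn x (n + 1)), subApply_zero j k _, ?_⟩
    rw [subApply_eq_cat j k x (n + 1), pre_succ', listApply_append, hx]
    simp [listApply]
  have htrue : ∀ (x : W2) (n : ℕ), x n = true → ∃ y : W2, y 0 = false ∧ subApply (tauS j k) x =
      cat (listApply (tauS j k) (pre x n) ++ tauS j k false) y := by
    intro x n hx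
    have hk : tauS j k true = tauS j k false ++ List.replicate (k - j - 1 + 1) false := by
      simp only [tauS, List.cons_append, Bool.false_eq_true, if_false, if_true,
        List.replicate_append_replicate]
      congr 2; omega
    refine ⟨cat (List.replicate (k - j - 1 + 1) false) (subApply (tauS j k) (shiftn x (n + 1))),
      by simp [cat], ?_⟩
    rw [subApply_eq_cat j k x (n + 1), pre_succ', listApply_append, hx, ← cat_append,
      List.append_assoc, ← hk]
    simp [listApply]
  obtain ⟨n, hn, ha, hb⟩ := h
  have hv := transport_listApply hjk o (pre a n)
  cases ho : o (pre a n)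
  · rw [ho] at ha hb
    obtain ⟨x, hx, hx'⟩ := htrue a n ha
    obtain ⟨y, hy, hy'⟩ := hfalse b n hb
    rw [hx', hy', ← hn.pre_eq]
    exact olt_cat _ (by rw [hx, hv, ho]; rfl) (by rw [hy, hv, ho]; rfl)
  · rw [ho] at ha hb
    obtain ⟨x, hx, hx'⟩ := hfalse a n ha
    obtain ⟨y, hy, hy'⟩ := htrue b n hb
    rw [hx', hy', ← hn.pre_eq]
    exact olt_cat _ (by rw [hx, hv, ho]; rfl) (by rw [hy, hv, ho]; rfl)

theorem ole_subApply (hjk : j < k) {a b : W2} (h : ole o a b) :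
    ole (transport (tauS j k) o) (subApply (tauS j k) a) (subApply (tauS j k) b) :=
  h.imp (congrArg _) (olt_subApply hjk)

/-- Words starting with `10^j1` or `10^k1` form an initial segment of those starting with `1`. -/
theorem IsBlock.of_ole (hjk : j < k) (ho : o [] = true) {a x : W2} (hx : IsBlock j k x)
    (h : ole (transport (tauS j k) o) a x) (ha : a 0 = true) : IsBlock j k a := by
  rcases h with rfl | ⟨n, hn, han, hxn⟩
  · exact hx
  obtain ⟨h0, i, hi, hp, h1⟩ := hx
  cases n with
  | zero =>
    rw [show pre a 0 = [] from rfl, transport_nil, ha] at han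
    simp at han
  | succ n =>
    by_cases hni : i < n
    · refine ⟨ha, i, hi, fun p hp1 hpi => ?_, ?_⟩
      · rw [hn p (by omega), hp p hp1 hpi]
      · rw [hn _ (by omega), h1]
    have hni' : n ≤ i := not_lt.1 hni
    have hpre : pre a (n + 1) = true :: List.replicate n false := by
      rw [pre_succ, ha]
      congr 1
      refine List.eq_replicate_iff.2 ⟨by simp, fun b hb => ?_⟩
      obtain ⟨m, rfl⟩ := List.mem_ofFn.1 hb
      show a (m + 1) = false
      rw [hn _ (by omega), hp _ (by omega) (by omega)]
    rw [hpre] at han hxn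
    by_cases hnj : n = j
    · subst hnj
      rw [transport_block_self hjk, ho] at han
      refine ⟨ha, n, Or.inl rfl, fun p hp1 hpn => ?_, by simpa using han⟩
      rw [hn _ (by omega), hp p hp1 (by omega)]
    · rw [transport_block_of_ne hnj] at hxn
      by_cases hnk : n = k
      · obtain rfl : i = n := by omega
        rw [h1] at hxn
        simp [hnk] at hxn
      · rw [hp _ (by omega) (by omega)] at hxn
        simp [hnk] at hxn

/-- If all tails of `b` starting with `1` are, up to repetition, the images of the tails of `a`,
then the suprema of tails correspond. -/
theorem IsTailMax.subApply (hjk : j < k) {a b x : W2} (h : IsTailMax o a x)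
    (hb : ∀ p, b p = false ∨ ∃ q, shiftn b p = subApply (tauS j k) (shiftn a q))
    (hb' : ∀ q, ∃ p, shiftn b p = subApply (tauS j k) (shiftn a q)) :
    IsTailMax (transport (tauS j k) o) b (subApply (tauS j k) x) := by
  refine ⟨fun p => ?_, fun n => ?_⟩
  · rcases hb p with hp | ⟨q, hq⟩
    · exact Or.inr (olt_of_zero (transport_nil j k o) (by simpa using hp) (subApply_zero j k x))
    · rw [hq]
      exact ole_subApply hjk (h.1 q)
  · obtain ⟨q, hq⟩ := h.2 n
    obtain ⟨p, hp⟩ := hb' q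
    exact ⟨p, hp ▸ (agree_subApply_succ hq).mono n.le_succ⟩

theorem subApply_mem_supWords (hjk : j < k) {x : W2} (hx : x ∈ supWords (ole o)) :
    subApply (tauS j k) x ∈ supWords (ole (transport (tauS j k) o)) := by
  obtain ⟨a, ha⟩ := mem_supWords_iff.1 hx
  exact mem_supWords_iff.2 ⟨_, ha.subApply hjk (shiftn_subApply j k a)
    (exists_shiftn_subApply j k a)⟩

theorem exists_subApply_eq_of_mem_supWords (hjk : j < k) (ho : o [] = true) {y : W2}
    (hy : y ∈ supWords (ole (transport (tauS j k) o))) (hblock : IsBlock j k y) :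
    ∃ x ∈ supWords (ole o), subApply (tauS j k) x = y := by
  obtain ⟨b, hb⟩ := mem_supWords_iff.1 hy
  have hex : ∃ p, b p = true := by
    obtain ⟨p, hp⟩ := hb.2 1
    exact ⟨p, by simpa [hblock.1] using hp 0 one_pos⟩
  have hblk : ∀ p, b p = true → IsBlock j k (shiftn b p) := fun p hp =>
    hblock.of_ole hjk ho (hb.1 p) (by simpa using hp)
  set p := Nat.find hex
  have hbp : b p = true := Nat.find_spec hex
  obtain ⟨a, hτ⟩ : ∃ a, subApply (tauS j k) a = shiftn b p := by
    refine ⟨_, subApply_decode hjk (by simpa using hbp) fun q hq => ?_⟩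
    rw [shiftn_shiftn]
    exact hblk _ (by rwa [shiftn_apply, add_comm] at hq)
  obtain ⟨x, hx⟩ := exists_isTailMax o a
  refine ⟨x, mem_supWords_iff.2 ⟨a, hx⟩, (hx.subApply hjk (fun q => ?_) fun q => ?_).unique hb⟩
  · by_cases hq : q < p
    · exact Or.inl (by simpa using Nat.find_min hex hq)
    · obtain ⟨d, rfl⟩ := Nat.exists_eq_add_of_le (not_lt.1 hq)
      have := shiftn_subApply j k a d
      rwa [hτ, shiftn_shiftn, shiftn_apply, add_comm d] at this
  · obtain ⟨d, hd⟩ := exists_shiftn_subApply j k a q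
    exact ⟨p + d, by rw [← hd, hτ, shiftn_shiftn]⟩

theorem isAccPt'_subApply (hjk : j < k) {x : W2} (hx : IsAccPt' (supWords (ole o)) x) :
    IsAccPt' (supWords (ole (transport (tauS j k) o))) (subApply (tauS j k) x) := by
  rw [isAccPt'_iff] at hx ⊢
  intro n
  obtain ⟨y, hy, hne, ha⟩ := hx n
  exact ⟨_, subApply_mem_supWords hjk hy, (subApply_injective hjk).ne hne,
    (agree_subApply_succ ha).mono n.le_succ⟩

/-- An accumulation point for the transported order is either larger than all images of words,
or the image of an accumulation point. -/
theorem isAccPt'_transport (hjk : j < k) (ho : o [] = true) {y : W2}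
    (hy : IsAccPt' (supWords (ole (transport (tauS j k) o))) y) :
    (∀ z, ole (transport (tauS j k) o) (subApply (tauS j k) z) y) ∨
      ∃ x, IsAccPt' (supWords (ole o)) x ∧ y = subApply (tauS j k) x := by
  have hy0 := zero_eq_true_of_isAccPt' (transport_nil j k o) hy
  by_cases hblock : IsBlock j k y
  · right
    rw [isAccPt'_iff] at hy
    have key : ∀ n, ∃ x ∈ supWords (ole o), subApply (tauS j k) x ≠ y ∧
        Agree n y (subApply (tauS j k) x) := by
      intro n
      obtain ⟨z, hz, hne, ha⟩ := hy (max n (k + 2))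
      obtain ⟨x, hx, rfl⟩ := exists_subApply_eq_of_mem_supWords hjk ho hz
        (hblock.congr hjk (ha.mono (le_max_right _ _)))
      exact ⟨x, hx, hne, ha.mono (le_max_left _ _)⟩
    obtain ⟨x, hx⟩ : ∃ x, subApply (tauS j k) x = y := by
      refine ⟨_, subApply_decode hjk hy0 fun p hp => ?_⟩
      obtain ⟨x, -, -, ha⟩ := key (k + 2 + p)
      obtain ⟨q, hq⟩ := (shiftn_subApply j k x p).resolve_left
        (by rw [← ha p (by omega), hp]; simp)
      refine (isBlock_subApply j k (shiftn x q)).congr hjk ?_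
      rw [← hq]
      exact fun i hi => (ha (i + p) (by omega)).symm
    refine ⟨x, isAccPt'_iff.2 fun n => ?_, hx.symm⟩
    obtain ⟨z, hz, hne, ha⟩ := key (n * (k + 1) + 1)
    rw [← hx] at ha hne
    exact ⟨z, hz, fun h => hne (h ▸ rfl), agree_of_agree_subApply hjk ha⟩
  · left
    intro z
    refine (olt_or_ole _ y _).resolve_left fun h => hblock ?_
    exact (isBlock_subApply j k z).of_ole hjk ho (Or.inr h) hy0

end Transport

/-! ### Finite compositions -/

/-- The lexicographic order. -/
abbrev lex : List Bool → Bool := fun _ => true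

theorem w10inf_ole_lex {y : W2} (hy : y 0 = true) : ole lex w10inf y := by
  refine (olt_or_ole _ y _).resolve_left ?_
  rintro ⟨n, -, hyn, h⟩
  obtain rfl : n = 0 := by simpa [w10inf] using h
  simp [hy] at hyn

theorem isSmallestAcc_lex : IsSmallestAcc (ole lex) (supWords (ole lex)) w10inf := by
  refine ⟨isAccPt'_iff.2 fun n => ?_, fun y hy => w10inf_ole_lex (zero_eq_true_of_isAccPt' rfl hy)⟩
  have hz : (fun i => decide (i = 0 ∨ i = n + 1) : W2) ≠ w10inf := fun h => by
    simpa [w10inf] using congrFun h (n + 1)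
  refine ⟨fun i => decide (i = 0 ∨ i = n + 1), mem_supWords_iff.2
    ⟨fun i => decide (i = 0 ∨ i = n + 1), fun p => ?_, fun _ => ⟨0, fun _ _ => rfl⟩⟩, hz, ?_⟩
  · by_cases hp0 : p = 0
    · exact Or.inl (by rw [hp0, shiftn_zero])
    by_cases hp : p = n + 1
    · have : shiftn (fun i => decide (i = 0 ∨ i = n + 1) : W2) p = w10inf := by
        funext i
        simp only [shiftn_apply, w10inf, hp]
        congr 1
        exact propext (by omega)
      rw [this]
      exact w10inf_ole_lex (by simp)
    · exact Or.inr (olt_of_zero rfl (by simp [hp0, hp]) (by simp))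
  · intro i hi
    have : i ≠ n + 1 := by omega
    simp [w10inf, this]

theorem exists_isSmallestAcc_applyList (L : List Sub2) (hL : ∀ f ∈ L, memS f) :
    ∃ o : List Bool → Bool, o [] = true ∧
      IsSmallestAcc (ole o) (supWords (ole o)) (applyList L w10inf) := by
  induction L with
  | nil => exact ⟨lex, rfl, isSmallestAcc_lex⟩
  | cons f L ih =>
    obtain ⟨o, ho, hacc, hmin⟩ := ih fun g hg => hL g (List.mem_cons_of_mem _ hg)
    obtain ⟨j, k, hjk, rfl⟩ := hL f List.mem_cons_self
    refine ⟨transport (tauS j k) o, transport_nil j k o, isAccPt'_subApply hjk hacc,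
      fun y hy => ?_⟩
    rcases isAccPt'_transport hjk ho hy with h | ⟨x, hx, rfl⟩
    · exact h _
    · exact ole_subApply hjk (hmin x hx)

/-! ### Infinite compositions -/

/-- Deletion of the first substitution. -/
def tail (σ : ℕ → Sub2) : ℕ → Sub2 := fun n => σ (n + 1)

theorem compUpTo_succ (σ : ℕ → Sub2) (n : ℕ) (a : W2) :
    compUpTo σ (n + 1) a = subApply (σ 0) (compUpTo (tail σ) n a) := by
  simp [compUpTo, applyList, List.ofFn_succ, tail]

theorem agree_compUpTo {σ : ℕ → Sub2} (hσ : ∀ n, memS (σ n)) (n : ℕ) (a b : W2) :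
    Agree n (compUpTo σ n a) (compUpTo σ n b) := by
  induction n generalizing σ with
  | zero => exact fun _ hi => absurd hi (Nat.not_lt_zero _)
  | succ n ih =>
    obtain ⟨j, k, -, hjk⟩ := hσ 0
    rw [compUpTo_succ, compUpTo_succ, hjk]
    exact agree_subApply_succ (ih fun n => hσ (n + 1))

theorem exists_compUpTo_add (σ : ℕ → Sub2) (n d : ℕ) (a : W2) :
    ∃ b, compUpTo σ (n + d) a = compUpTo σ n b := by
  induction n generalizing σ with
  | zero => exact ⟨compUpTo σ (0 + d) a, rfl⟩
  | succ n ih =>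
    obtain ⟨b, hb⟩ := ih (tail σ)
    exact ⟨b, by rw [add_right_comm, compUpTo_succ, compUpTo_succ, hb]⟩

/-- The limit word of `σ`. -/
def limitWord (σ : ℕ → Sub2) : W2 := fun n => compUpTo σ (n + 1) w1 n

theorem agree_limitWord {σ : ℕ → Sub2} (hσ : ∀ n, memS (σ n)) (n : ℕ) (a : W2) :
    Agree n (compUpTo σ n a) (limitWord σ) := by
  intro i hi
  obtain ⟨d, rfl⟩ := Nat.exists_eq_add_of_le (Nat.succ_le_of_lt hi)
  obtain ⟨b, hb⟩ := exists_compUpTo_add σ (i + 1) d a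
  rw [Nat.succ_eq_add_one, hb]
  exact agree_compUpTo hσ (i + 1) b w1 i i.lt_succ_self

theorem isLimitWord_limitWord {σ : ℕ → Sub2} (hσ : ∀ n, memS (σ n)) :
    IsLimitWord σ w1 (limitWord σ) := by
  intro ε hε
  obtain ⟨N, hN⟩ := exists_pow_lt hε
  exact ⟨N, fun n hn => (wdist_le_iff.2 ((agree_limitWord hσ n w1).mono hn)).trans_lt hN⟩

theorem limitWord_eq_subApply {σ : ℕ → Sub2} (hσ : ∀ n, memS (σ n)) :
    limitWord σ = subApply (σ 0) (limitWord (tail σ)) := by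
  obtain ⟨j, k, -, hjk⟩ := hσ 0
  refine eq_of_forall_agree fun n => ?_
  refine ((agree_limitWord hσ (n + 1) w1).mono n.le_succ).symm.trans ?_
  rw [compUpTo_succ, hjk]
  exact (agree_subApply_succ (agree_limitWord (fun n => hσ (n + 1)) n w1)).mono n.le_succ

/-- The lexicographic orientation transported along the first substitutions of `σ`. -/
def partialOrient : ℕ → (ℕ → Sub2) → List Bool → Bool
  | 0, _ => lex
  | n + 1, σ => transport (σ 0) (partialOrient n (tail σ))

/-- The orientation obtained by transporting along all substitutions of `σ`. -/
def limitOrient (σ : ℕ → Sub2) (v : List Bool) : Bool := partialOrient (v.length + 1) σ v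

theorem transport_congr {f : Sub2} (hf : memS f) {o o' : List Bool → Bool} {v : List Bool}
    (h : ∀ w, w.length < v.length → o w = o' w) : transport f o v = transport f o' v := by
  obtain ⟨j, k, hjk, rfl⟩ := hf
  by_cases hv : ∃ w, v = listApply (tauS j k) w ++ tauS j k false
  · obtain ⟨w, rfl⟩ := hv
    rw [transport_listApply hjk, transport_listApply hjk, h]
    have := length_le_length_listApply j k w
    rw [List.length_append, length_tauS]
    omega
  · rw [transport, transport, dif_neg hv, dif_neg hv]

theorem partialOrient_eq {σ : ℕ → Sub2} (hσ : ∀ n, memS (σ n)) {m n : ℕ} {v : List Bool}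
    (hm : v.length < m) (hn : v.length < n) : partialOrient m σ v = partialOrient n σ v := by
  induction m generalizing n σ v with
  | zero => omega
  | succ m ih =>
    obtain ⟨n, rfl⟩ : ∃ d, n = d + 1 := ⟨n - 1, by omega⟩
    exact transport_congr (hσ 0) fun w hw => ih (fun n => hσ (n + 1)) (by omega) (by omega)

theorem limitOrient_eq_transport {σ : ℕ → Sub2} (hσ : ∀ n, memS (σ n)) :
    limitOrient σ = transport (σ 0) (limitOrient (tail σ)) :=
  funext fun _ => transport_congr (hσ 0) fun _ hw =>
    partialOrient_eq (fun n => hσ (n + 1)) hw (Nat.lt_succ_self _)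

theorem limitOrient_nil {σ : ℕ → Sub2} (hσ : ∀ n, memS (σ n)) : limitOrient σ [] = true := by
  obtain ⟨j, k, -, hjk⟩ := hσ 0
  rw [limitOrient_eq_transport hσ, hjk, transport_nil]

theorem exists_compUpTo_mem_supWords {σ : ℕ → Sub2} (hσ : ∀ n, memS (σ n)) (n : ℕ) :
    ∃ a b, compUpTo σ n a ≠ compUpTo σ n b ∧
      compUpTo σ n a ∈ supWords (ole (limitOrient σ)) ∧
      compUpTo σ n b ∈ supWords (ole (limitOrient σ)) := by
  induction n generalizing σ with
  | zero =>
    have hne : w1 ≠ w10inf := fun h => by simpa [w1, w10inf] using congrFun h 1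
    exact ⟨w1, w10inf, hne, w1_mem_supWords _, w10inf_mem_supWords (limitOrient_nil hσ)⟩
  | succ n ih =>
    obtain ⟨a, b, hne, ha, hb⟩ := @ih (tail σ) fun n => hσ (n + 1)
    obtain ⟨j, k, hjk, hf⟩ := hσ 0
    refine ⟨a, b, ?_⟩
    rw [limitOrient_eq_transport hσ, compUpTo_succ, compUpTo_succ, hf]
    exact ⟨(subApply_injective hjk).ne hne, subApply_mem_supWords hjk ha,
      subApply_mem_supWords hjk hb⟩

theorem isAccPt'_limitWord {σ : ℕ → Sub2} (hσ : ∀ n, memS (σ n)) :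
    IsAccPt' (supWords (ole (limitOrient σ))) (limitWord σ) := by
  refine isAccPt'_iff.2 fun n => ?_
  obtain ⟨a, b, hne, ha, hb⟩ := exists_compUpTo_mem_supWords hσ n
  by_cases h : compUpTo σ n a = limitWord σ
  · exact ⟨_, hb, fun h' => hne (h.trans h'.symm), (agree_limitWord hσ n b).symm⟩
  · exact ⟨_, ha, h, (agree_limitWord hσ n a).symm⟩

theorem ole_limitWord_or_agree {σ : ℕ → Sub2} (hσ : ∀ n, memS (σ n)) {y : W2}
    (hy : IsAccPt' (supWords (ole (limitOrient σ))) y) (n : ℕ) :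
    ole (limitOrient σ) (limitWord σ) y ∨ Agree n (limitWord σ) y := by
  induction n generalizing σ y with
  | zero => exact Or.inr fun _ hi => absurd hi (Nat.not_lt_zero _)
  | succ n ih =>
    have hσ' : ∀ n, memS (tail σ n) := fun n => hσ (n + 1)
    obtain ⟨j, k, hjk, hf⟩ := hσ 0
    rw [limitOrient_eq_transport hσ, hf] at hy ⊢
    rw [limitWord_eq_subApply hσ, hf]
    rcases isAccPt'_transport hjk (limitOrient_nil hσ') hy with h | ⟨x, hx, rfl⟩
    · exact Or.inl (h _)
    · exact (ih hσ' hx).imp (ole_subApply hjk) agree_subApply_succ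

theorem isSmallestAcc_limitWord {σ : ℕ → Sub2} (hσ : ∀ n, memS (σ n)) :
    IsSmallestAcc (ole (limitOrient σ)) (supWords (ole (limitOrient σ))) (limitWord σ) := by
  refine ⟨isAccPt'_limitWord hσ, fun y hy => ?_⟩
  by_contra h
  exact h (Or.inl (eq_of_forall_agree fun n => (ole_limitWord_or_agree hσ hy n).resolve_left h))

end CylinderWords

open CylinderWords in
/-- For every `σ ∈ S*` there is a cylinder order `≤` on `{0,1}^∞` with
`0^∞ < 1^∞` and `m_≤ = σ(10^∞)`; and for every `σ ∈ S^∞` there is a cylinder order `≤`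
with `0^∞ < 1^∞` and `m_≤ = lim_{n→∞} σ_{[1,n]}(1^∞)`. -/
theorem stmt_7 :
    (∀ L : List Sub2, (∀ f ∈ L, memS f) →
      ∃ le : W2 → W2 → Prop, IsCylOrder le ∧ wlt le w0 w1 ∧
        IsSmallestAcc le (supWords le) (applyList L w10inf)) ∧
    (∀ σ : ℕ → Sub2, (∀ n, memS (σ n)) →
      ∃ le : W2 → W2 → Prop, IsCylOrder le ∧ wlt le w0 w1 ∧
        ∃ m : W2, IsLimitWord σ w1 m ∧ IsSmallestAcc le (supWords le) m) := by
  refine ⟨fun L hL => ?_, fun σ hσ => ?_⟩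
  · obtain ⟨o, ho, h⟩ := exists_isSmallestAcc_applyList L hL
    exact ⟨ole o, isCylOrder_ole o, wlt_ole_w0_w1 ho, h⟩
  · exact ⟨ole (limitOrient σ), isCylOrder_ole _, wlt_ole_w0_w1 (limitOrient_nil hσ),
      limitWord σ, isLimitWord_limitWord hσ, isSmallestAcc_limitWord hσ⟩
end
end

section
/- Let ≤ be a cylinder order on {0,1}^∞ with 0^∞ < 1^∞. (i) If m_≤ = σ(1^∞) for some σ = (σ_n)_{n≥1} ∈ S^∞, then {a ∈ M_≤ : a < m_≤} = {(σ_{[1,n]}(0))^∞ : n ≥ 0}. (ii) If m_≤ = σ_{[1,h]}(10^∞) with σ_1, …, σ_h ∈ S and h ≥ 0, then {a ∈ M_≤ : a < m_≤} = {(σ_{[1,n]}(0))^∞ : 0 ≤ n ≤ h} ∪ {σ_{[1,h]}((10^j)^∞) : j ≥ 0, σ_{[1,h]}((10^j)^∞) < m_≤}, and there is at most one j ≥ 0 with σ_{[1,h]}((10^j)^∞) < m_≤. -/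
open scoped Classical

noncomputable section

/-- The infinite word obtained by writing the finite word `l` in front of `a`. -/
def prepend : List Bool → (ℕ → Bool) → ℕ → Bool
  | [], a, n => a n
  | _ :: l, a, n + 1 => prepend l a n
  | b :: _, _, 0 => b

/-- The block word `10^j a`. -/
def block (j : ℕ) (a : W2) : W2 := prepend (true :: List.replicate j false) a

section Words

@[simp] lemma prepend_nil (a : W2) : prepend [] a = a := rfl

@[simp] lemma prepend_cons_zero (b : Bool) (l : List Bool) (a : W2) :
    prepend (b :: l) a 0 = b := rfl

@[simp] lemma prepend_cons_succ (b : Bool) (l : List Bool) (a : W2) (n : ℕ) :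
    prepend (b :: l) a (n + 1) = prepend l a n := rfl

lemma prepend_cons (b : Bool) (l : List Bool) (a : W2) :
    prepend (b :: l) a = prepend [b] (prepend l a) := by
  funext n
  cases n <;> rfl

lemma prepend_append (l l' : List Bool) (a : W2) :
    prepend (l ++ l') a = prepend l (prepend l' a) := by
  induction l with
  | nil => rfl
  | cons b l ih => rw [List.cons_append, prepend_cons, ih, ← prepend_cons]

lemma prepend_apply (l : List Bool) (a : W2) (n : ℕ) :
    prepend l a n = if n < l.length then l.getD n false else a (n - l.length) := by
  induction l generalizing n with
  | nil => simp
  | cons b l ih => cases n <;> simp [ih]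

lemma prepend_length_add (l : List Bool) (a : W2) (n : ℕ) :
    prepend l a (l.length + n) = a n := by
  simp [prepend_apply]

lemma prepend_congr {l : List Bool} {a b : W2} {p : ℕ}
    (h : ∀ q, q + l.length = p → a q = b q) : prepend l a p = prepend l b p := by
  rw [prepend_apply, prepend_apply]
  split_ifs with hp
  · rfl
  · exact h _ (by omega)

lemma prepend_injective (l : List Bool) : Function.Injective (prepend l) := by
  intro a b h
  funext n
  rw [← prepend_length_add l a n, h, prepend_length_add]

@[simp] lemma shiftn_zero (a : W2) : shiftn a 0 = a := rfl

lemma shiftn_shiftn (a : W2) (m n : ℕ) : shiftn (shiftn a m) n = shiftn a (m + n) := by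
  funext i
  simp only [shiftn]
  congr 1
  omega

lemma shiftn_prepend (l : List Bool) (a : W2) (n : ℕ) :
    shiftn (prepend l a) (l.length + n) = shiftn a n := by
  funext i
  rw [shiftn, show i + (l.length + n) = l.length + (i + n) by omega, prepend_length_add]
  rfl

lemma prepend_head_shiftn (a : W2) : prepend [a 0] (shiftn a 1) = a := by
  funext n
  cases n <;> rfl

lemma exists_eq_prepend_of_agree {s t : W2} {n : ℕ} (h : ∀ i < n, s i = t i) :
    ∃ l : List Bool, l.length = n ∧ s = prepend l (shiftn s n) ∧ t = prepend l (shiftn t n) := by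
  induction n generalizing s t with
  | zero => exact ⟨[], rfl, rfl, rfl⟩
  | succ n ih =>
    obtain ⟨l, hl, hs, ht⟩ := ih (s := shiftn s 1) (t := shiftn t 1)
      fun i hi => h (i + 1) (by omega)
    rw [shiftn_shiftn, add_comm 1 n] at hs ht
    refine ⟨s 0 :: l, by simp [hl], ?_, ?_⟩
    · rw [prepend_cons, ← hs, prepend_head_shiftn]
    · rw [prepend_cons, ← ht, h 0 (by omega), prepend_head_shiftn]

lemma exists_first_ne {s t : W2} (h : s ≠ t) : ∃ n, (∀ i < n, s i = t i) ∧ s n ≠ t n := by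
  have hex : ∃ n, s n ≠ t n := Function.ne_iff.1 h
  exact ⟨Nat.find hex, fun i hi => not_not.1 (Nat.find_min hex hi), Nat.find_spec hex⟩

lemma exists_first_difference {s t : W2} (h : s ≠ t) :
    ∃ (l : List Bool) (s' t' : W2), s = prepend l s' ∧ t = prepend l t' ∧ s' 0 ≠ t' 0 := by
  obtain ⟨n, hagree, hn⟩ := exists_first_ne h
  obtain ⟨l, -, hs, ht⟩ := exists_eq_prepend_of_agree hagree
  exact ⟨l, _, _, hs, ht, by simpa [shiftn] using hn⟩

lemma eq_of_forall_eq_prepend {w : List Bool} (hw : w ≠ []) {P : W2 → Prop} {t u : W2}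
    (hu : u = prepend w u) (hP : ∀ t, P t → ∃ t', t = prepend w t' ∧ P t') (ht : P t) :
    t = u := by
  have hlen := List.length_pos_iff.2 hw
  funext p
  induction p using Nat.strong_induction_on generalizing t with
  | _ p ih =>
    obtain ⟨t', rfl, ht'⟩ := hP t ht
    rw [hu]
    exact prepend_congr fun q hq => ih q (by omega) ht'

lemma perW_eq_prepend (w : List Bool) : perW w = prepend w (perW w) := by
  funext n
  rw [prepend_apply]
  split_ifs with h
  · rw [perW, Nat.mod_eq_of_lt h]
  · rw [perW, perW, Nat.mod_eq_sub_mod (not_lt.1 h)]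

lemma eq_perW {w : List Bool} (hw : w ≠ []) {s : W2} (hs : s = prepend w s) : s = perW w :=
  eq_of_forall_eq_prepend (P := fun t => t = s) hw (perW_eq_prepend w)
    (fun _ ht => ⟨s, ht ▸ hs, rfl⟩) rfl

lemma perW_false : perW [false] = w0 := by
  funext n
  simp [perW, w0, Nat.mod_one]

end Words

section Substitutions

variable {f : Sub2}

lemma listApply_append (f : Sub2) (l l' : List Bool) :
    listApply f (l ++ l') = listApply f l ++ listApply f l' := by
  simp [listApply]

lemma listApply_cons (f : Sub2) (b : Bool) (l : List Bool) :
    listApply f (b :: l) = f b ++ listApply f l := by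
  simp [listApply]

lemma length_le_length_listApply (hf : ∀ b, f b ≠ []) (l : List Bool) :
    l.length ≤ (listApply f l).length := by
  induction l with
  | nil => simp
  | cons b l ih =>
    have := List.length_pos_iff.2 (hf b)
    rw [listApply_cons, List.length_append, List.length_cons]
    omega

lemma getD_listApply_ofFn (hf : ∀ b, f b ≠ []) (a : W2) {n N : ℕ} (hN : n + 1 ≤ N) :
    (listApply f (List.ofFn fun i : Fin N => a i.val)).getD n false = subApply f a n := by
  induction N, hN using Nat.le_induction with
  | base => rfl
  | succ N hN ih =>
    have hlen := length_le_length_listApply hf (List.ofFn fun i : Fin N => a i.val)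
    rw [List.length_ofFn] at hlen
    rw [List.ofFn_succ_last, listApply_append, List.getD_append _ _ _ _ (by simpa using by omega)]
    exact ih

lemma subApply_eq_prepend (hf : ∀ b, f b ≠ []) (a : W2) :
    subApply f a = prepend (f (a 0)) (subApply f (shiftn a 1)) := by
  funext n
  have hlen := List.length_pos_iff.2 (hf (a 0))
  rw [prepend_apply]
  have h : subApply f a n = (f (a 0) ++
      listApply f (List.ofFn fun i : Fin n => shiftn a 1 i.val)).getD n false := by
    rw [subApply, List.ofFn_succ, listApply_cons]
    rfl
  rw [h]
  split_ifs with hn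
  · rw [List.getD_append _ _ _ _ hn]
  · rw [List.getD_append_right _ _ _ _ (not_lt.1 hn), getD_listApply_ofFn hf _ (by omega)]

lemma subApply_prepend (hf : ∀ b, f b ≠ []) (l : List Bool) (a : W2) :
    subApply f (prepend l a) = prepend (listApply f l) (subApply f a) := by
  induction l with
  | nil => rfl
  | cons b l ih =>
    rw [subApply_eq_prepend hf, listApply_cons, prepend_append, ← ih]
    rfl

lemma listApply_ne_nil (hf : ∀ b, f b ≠ []) {l : List Bool} (hl : l ≠ []) :
    listApply f l ≠ [] := by
  have h := length_le_length_listApply hf l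
  have hl' := List.length_pos_iff.2 hl
  exact List.length_pos_iff.1 (by omega)

lemma subApply_perW (hf : ∀ b, f b ≠ []) {w : List Bool} (hw : w ≠ []) :
    subApply f (perW w) = perW (listApply f w) := by
  refine eq_perW (listApply_ne_nil hf hw) ?_
  rw [← subApply_prepend hf, ← perW_eq_prepend]

lemma exists_eq_subApply (hf : ∀ b, f b ≠ []) {P : W2 → Prop}
    (hP : ∀ t, P t → ∃ b t', t = prepend (f b) t' ∧ P t') {t : W2} (ht : P t) :
    ∃ a, t = subApply f a := by
  choose b t' h1 h2 using hP
  let u : ℕ → {t // P t} := fun n => Nat.rec ⟨t, ht⟩ (fun _ s => ⟨t' s.1 s.2, h2 s.1 s.2⟩) n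
  let a : W2 := fun n => b (u n).1 (u n).2
  have key : ∀ p n, (u n).1 p = subApply f (shiftn a n) p := by
    intro p
    induction p using Nat.strong_induction_on with
    | _ p ih =>
      intro n
      have hlen := List.length_pos_iff.2 (hf (b (u n).1 (u n).2))
      rw [h1 (u n).1 (u n).2, subApply_eq_prepend hf, shiftn_shiftn,
        show shiftn a n 0 = a n by simp [shiftn]]
      exact prepend_congr fun q hq => ih q (by omega) (n + 1)
  exact ⟨a, funext fun p => key p 0⟩

lemma exists_shiftn_subApply (hf : ∀ b, f b ≠ []) (a : W2) (n : ℕ) :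
    ∃ m, shiftn (subApply f a) m = subApply f (shiftn a n) := by
  induction n generalizing a with
  | zero => exact ⟨0, rfl⟩
  | succ n ih =>
    obtain ⟨m, hm⟩ := ih (shiftn a 1)
    refine ⟨(f (a 0)).length + m, ?_⟩
    rw [subApply_eq_prepend hf, shiftn_prepend, hm, shiftn_shiftn, add_comm 1 n]

lemma listApplyL_ne_nil {L : List Sub2} (hL : ∀ f ∈ L, ∀ b, f b ≠ []) {l : List Bool}
    (hl : l ≠ []) : listApplyL L l ≠ [] := by
  induction L with
  | nil => exact hl
  | cons f L ih =>
    exact listApply_ne_nil (hL f (by simp)) (ih fun g hg => hL g (by simp [hg]))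

lemma tauS_ne_nil (j k : ℕ) (b : Bool) : tauS j k b ≠ [] := by
  simp [tauS]

lemma memS.ne_nil (hf : memS f) (b : Bool) : f b ≠ [] := by
  obtain ⟨j, k, -, rfl⟩ := hf
  exact tauS_ne_nil j k b

variable {j k : ℕ}

lemma subApply_tauS (j k : ℕ) (a : W2) :
    subApply (tauS j k) a = block (if a 0 then k else j) (subApply (tauS j k) (shiftn a 1)) :=
  subApply_eq_prepend (tauS_ne_nil j k) a

@[simp] lemma subApply_tauS_zero (j k : ℕ) (a : W2) : subApply (tauS j k) a 0 = true := by
  rw [subApply_tauS]; rfl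

lemma shiftn_subApply_tauS (j k : ℕ) (a : W2) (n : ℕ) :
    shiftn (subApply (tauS j k) a) n 0 = false ∨
      ∃ m, shiftn (subApply (tauS j k) a) n = subApply (tauS j k) (shiftn a m) := by
  induction n using Nat.strong_induction_on generalizing a with
  | _ n ih =>
    rcases Nat.eq_zero_or_pos n with rfl | hn
    · exact Or.inr ⟨0, rfl⟩
    rw [subApply_tauS]
    set i := if a 0 then k else j
    by_cases hi : n ≤ i
    · left
      obtain ⟨n, rfl⟩ : ∃ n', n = n' + 1 := ⟨n - 1, by omega⟩
      have : n < i := hi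
      simp [block, shiftn, prepend_apply, this]
    · obtain ⟨r, rfl⟩ : ∃ r, n = (true :: List.replicate i false).length + r :=
        ⟨n - (i + 1), by simp; omega⟩
      rw [block, shiftn_prepend]
      rcases ih r (by simp) (shiftn a 1) with h | ⟨m, h⟩
      · exact Or.inl h
      · exact Or.inr ⟨1 + m, by rw [h, shiftn_shiftn]⟩

lemma subApply_tauS_false {a : W2} (ha : a 0 = false) :
    subApply (tauS j k) a = block j (subApply (tauS j k) (shiftn a 1)) := by
  rw [subApply_tauS, ha]; rfl

lemma block_add (i d : ℕ) (a : W2) :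
    block (i + d) a = block i (prepend (List.replicate d false) a) := by
  rw [block, List.replicate_add, ← List.cons_append, prepend_append]; rfl

lemma exists_block_of_lt {i j : ℕ} (hij : i < j) (a : W2) :
    ∃ b : W2, b 0 = false ∧ block j a = block i b := by
  obtain ⟨d, rfl⟩ := Nat.exists_eq_add_of_lt hij
  exact ⟨prepend (List.replicate (d + 1) false) a, rfl, by rw [add_assoc, block_add]⟩

lemma block_w0 (i : ℕ) : block i w0 = w10inf := by
  funext n
  cases n with
  | zero => rfl
  | succ n => simp [block, prepend_apply, w10inf, w0]

lemma block_ne_w10inf {i : ℕ} {a : W2} (ha : a 0 = true) : block i a ≠ w10inf := by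
  intro heq
  rw [← block_w0 i] at heq
  rw [prepend_injective _ heq] at ha
  simp [w0] at ha

lemma perW_block_eq_block (i : ℕ) :
    perW (true :: List.replicate i false) = block i (perW (true :: List.replicate i false)) :=
  perW_eq_prepend _

lemma subApply_tauS_true {a : W2} (ha : a 0 = true) :
    subApply (tauS j k) a = block k (subApply (tauS j k) (shiftn a 1)) := by
  rw [subApply_tauS, ha]; rfl

/-- Under `τ_{j,k}`, images of words with different first letters branch after `10^j`. -/
lemma exists_subApply_tauS_eq_block (hjk : j < k) (a : W2) :
    ∃ u : W2, u 0 = !a 0 ∧ subApply (tauS j k) a = block j u := by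
  cases ha : a 0 with
  | false => exact ⟨_, subApply_tauS_zero _ _ _, subApply_tauS_false ha⟩
  | true =>
    rw [subApply_tauS_true ha]
    exact exists_block_of_lt hjk _

lemma subApply_tauS_injective (hjk : j < k) : Function.Injective (subApply (tauS j k)) := by
  intro a b h
  by_contra hab
  obtain ⟨l, a, b, rfl, rfl, h0⟩ := exists_first_difference hab
  rw [subApply_prepend (tauS_ne_nil j k), subApply_prepend (tauS_ne_nil j k)] at h
  have h' := prepend_injective _ h
  obtain ⟨u, hu, hua⟩ := exists_subApply_tauS_eq_block hjk a
  obtain ⟨v, hv, hvb⟩ := exists_subApply_tauS_eq_block hjk b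
  rw [hua, hvb] at h'
  rw [prepend_injective _ h', hv] at hu
  exact h0 (Bool.not_inj hu).symm

lemma eq_w10inf_or_block {t : W2} (ht : t 0 = true) :
    t = w10inf ∨ ∃ i u, u 0 = true ∧ t = block i u := by
  classical
  by_cases h : ∃ n, t (n + 1) = true
  · right
    refine ⟨Nat.find h, shiftn t (Nat.find h + 1), ?_, ?_⟩
    · simpa [shiftn] using Nat.find_spec h
    · funext n
      cases n with
      | zero => exact ht
      | succ n =>
        rw [block, prepend_cons_succ, prepend_apply, List.length_replicate]
        split_ifs with hn
        · simpa [hn] using Nat.find_min h hn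
        · rw [shiftn]
          congr 1
          omega
  · left
    funext n
    cases n with
    | zero => simpa [w10inf] using ht
    | succ n => simpa [w10inf] using fun hn => h ⟨n, hn⟩

lemma shiftn_block (i : ℕ) (a : W2) : shiftn (block i a) (i + 1) = a := by
  have := shiftn_prepend (true :: List.replicate i false) a 0
  rwa [List.length_cons, List.length_replicate, add_zero, shiftn_zero] at this

lemma block_ne_block_of_lt {i j : ℕ} (hij : i < j) {a b : W2} (ha : a 0 = true) :
    block i a ≠ block j b := by
  obtain ⟨c, hc, hbc⟩ := exists_block_of_lt hij b
  rw [hbc]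
  intro heq
  rw [prepend_injective _ heq, hc] at ha
  exact Bool.false_ne_true ha

lemma eq_block_of_agree {i : ℕ} {a b : W2} (hab : ∀ n ≤ i, a n = block i b n) :
    a = block i (shiftn a (i + 1)) := by
  funext n
  by_cases hn : n ≤ i
  · rw [hab n hn]
    exact prepend_congr fun q hq => by simp at hq; omega
  · rw [block, prepend_apply, if_neg (by simpa using hn), shiftn]
    congr 1
    simp
    omega

lemma subApply_tauS_one (hjk : j < k) {a : W2} (ha : a 0 = true) :
    subApply (tauS j k) a 1 = false := by
  obtain ⟨d, rfl⟩ := Nat.exists_eq_add_of_lt hjk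
  rw [subApply_tauS_true ha]
  rfl

lemma length_listApply_tauS_le (hjk : j < k) (l : List Bool) :
    (listApply (tauS j k) l).length ≤ (k + 1) * l.length := by
  induction l with
  | nil => simp [listApply]
  | cons b l ih =>
    have hb : (tauS j k b).length ≤ k + 1 := by
      cases b <;> simp [tauS]
      omega
    rw [listApply_cons, List.length_append, List.length_cons, mul_add]
    omega

/-- Two words that agree on `n` letters have images that agree on at least `n` letters, and on at
least `n + 1` letters if both words start with `1`. -/
lemma subApply_tauS_congr (hjk : j < k) {a b : W2} {n : ℕ} (h : ∀ i < n, a i = b i) :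
    ∀ i < n + (if a 0 = true ∧ 0 < n then 1 else 0),
      subApply (tauS j k) a i = subApply (tauS j k) b i := by
  obtain ⟨l, hl, ha, hb⟩ := exists_eq_prepend_of_agree h
  have hlen : n + (if a 0 = true ∧ 0 < n then 1 else 0) ≤ (listApply (tauS j k) l).length := by
    have h1 := length_le_length_listApply (tauS_ne_nil j k) l
    split_ifs with h0
    · cases l with
      | nil => simp at hl; omega
      | cons c l =>
        have hc : c = true := by rw [ha] at h0; exact h0.1
        have h2 := length_le_length_listApply (tauS_ne_nil j k) l
        simp only [hc, listApply_cons, tauS, List.length_append, List.length_cons,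
          List.length_replicate, if_true] at hl ⊢
        omega
    · omega
  intro i hi
  rw [ha, hb, subApply_prepend (tauS_ne_nil j k), subApply_prepend (tauS_ne_nil j k)]
  exact prepend_congr fun q hq => by omega

end Substitutions

/-- A total order in which the comparison of two words depends only on their prefixes up to and
including the first position where they differ. -/
structure IsPrefixOrder (le : W2 → W2 → Prop) : Prop where
  total : ∀ a b, le a b ∨ le b a
  antisymm : ∀ a b, le a b → le b a → a = b
  trans : ∀ a b c, le a b → le b c → le a c
  prefix_le : ∀ (l : List Bool) (a b c d : W2), a 0 ≠ b 0 → c 0 = a 0 → d 0 = b 0 →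
    le (prepend l a) (prepend l b) → le (prepend l c) (prepend l d)

/-- `10^j1⋯ < 10^j0⋯` -/
def IsAscending (le : W2 → W2 → Prop) (j : ℕ) : Prop := le (block j w1) (block j w0)

/-- The order obtained by comparing images under `f`. -/
def pullback (f : Sub2) (le : W2 → W2 → Prop) : W2 → W2 → Prop :=
  fun a b => le (subApply f a) (subApply f b)

section Distance

variable {A : Type*} [DecidableEq A]

lemma wdist_lt_iff (a b : ℕ → A) (n : ℕ) :
    wdist a b < (2 : ℝ)⁻¹ ^ n ↔ ∀ i < n, a i = b i := by
  rw [wdist]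
  split_ifs with h
  · rw [pow_lt_pow_iff_right_of_lt_one₀ (by norm_num) (by norm_num), Nat.lt_succ_iff,
      Nat.le_find_iff]
    simp only [not_not]
  · push Not at h
    simp [h]

lemma isAccPt'_iff {M : Set (ℕ → A)} {x : ℕ → A} :
    IsAccPt' M x ↔ ∀ n : ℕ, ∃ y ∈ M, y ≠ x ∧ ∀ i < n, x i = y i := by
  constructor
  · intro h n
    obtain ⟨y, hy, hyx, hd⟩ := h ((2 : ℝ)⁻¹ ^ n) (by positivity)
    exact ⟨y, hy, hyx, (wdist_lt_iff x y n).1 hd⟩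
  · intro h ε hε
    obtain ⟨n, hn⟩ := exists_pow_lt_of_lt_one hε (show (2 : ℝ)⁻¹ < 1 by norm_num)
    obtain ⟨y, hy, hyx, hd⟩ := h n
    exact ⟨y, hy, hyx, ((wdist_lt_iff x y n).2 hd).trans hn⟩

end Distance

section Orders

variable {le : W2 → W2 → Prop} {j k : ℕ}

lemma IsCylOrder.isPrefixOrder (h : IsCylOrder le) :
    IsPrefixOrder le := by
  obtain ⟨total, antisymm, trans, dist⟩ := h
  refine ⟨total, antisymm, trans, fun l a b a' b' hab ha hb hle => ?_⟩
  have agree : ∀ x y : W2, x 0 = y 0 →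
      wdist (prepend l x) (prepend l y) < (2 : ℝ)⁻¹ ^ (l.length + 1) := by
    intro x y hxy
    refine (wdist_lt_iff _ _ _).2 fun i hi => prepend_congr fun q hq => ?_
    have hq0 : q = 0 := by omega
    rw [hq0, hxy]
  have differ : ∀ x y : W2, x 0 ≠ y 0 →
      ¬ wdist (prepend l x) (prepend l y) < (2 : ℝ)⁻¹ ^ (l.length + 1) := by
    intro x y hxy hlt
    have := (wdist_lt_iff _ _ _).1 hlt (l.length + 0) (by omega)
    rw [prepend_length_add, prepend_length_add] at this
    exact hxy this
  have h1 : le (prepend l a') (prepend l b) := by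
    refine (total _ _).resolve_right fun hlt => ?_
    exact differ _ _ hab ((dist _ _ _ hle hlt).trans_lt (agree _ _ ha.symm))
  refine (total _ _).resolve_right fun hlt => ?_
  refine differ b' a' (fun h => hab ?_) ((dist _ _ _ hlt h1).trans_lt (agree _ _ hb))
  rw [← ha, ← hb, h]

namespace IsPrefixOrder

variable (h : IsPrefixOrder le)
include h

lemma refl (a : W2) : le a a := (h.total a a).elim id id

lemma le_of_agree {a b a' b' : W2} {n : ℕ} (hab : ∀ i < n, a i = b i) (hn : a n ≠ b n)
    (ha : ∀ i ≤ n, a' i = a i) (hb : ∀ i ≤ n, b' i = b i) (hle : le a b) : le a' b' := by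
  obtain ⟨l, hl, ha1, hb1⟩ := exists_eq_prepend_of_agree hab
  have split : ∀ x y : W2, x = prepend l (shiftn x n) → (∀ i ≤ n, y i = x i) →
      y = prepend l (shiftn y n) := by
    intro x y hx hxy
    funext i
    rw [prepend_apply]
    split_ifs with hi
    · rw [hxy i (by omega), hx, prepend_apply, if_pos hi]
    · rw [shiftn]
      congr 1
      omega
  rw [split a a' ha1 ha, split b b' hb1 hb]
  rw [ha1, hb1] at hle
  refine h.prefix_le l _ _ _ _ ?_ ?_ ?_ hle
  · simpa [shiftn] using hn
  · simpa [shiftn] using ha n le_rfl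
  · simpa [shiftn] using hb n le_rfl

lemma exists_not_le_of_agree {a b : W2} (hab : ¬ le a b) :
    ∃ n, ∀ a' b' : W2, (∀ i < n, a' i = a i) → (∀ i < n, b' i = b i) → ¬ le a' b' := by
  obtain ⟨n, hagree, hn⟩ := exists_first_ne fun hba : b = a => hab (hba ▸ h.refl b)
  refine ⟨n + 1, fun a' b' ha hb hle => hn ?_⟩
  have hba : le b' a' := h.le_of_agree hagree hn (fun i hi => hb i (by omega))
    (fun i hi => ha i (by omega)) ((h.total _ _).resolve_left hab)
  rw [← ha n (by omega), ← hb n (by omega), h.antisymm _ _ hle hba]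

/-- Every nonempty set of words has an upper bound in its closure. -/
lemma exists_upperBound_mem_closure {T : Set W2} (hT : T.Nonempty) :
    ∃ b, (∀ t ∈ T, le t b) ∧ ∀ n, ∃ t ∈ T, ∀ i < n, t i = b i := by
  have step : ∀ n, ∃ s ∈ T, ∀ t ∈ T, le t s ∨ ∀ i < n, t i = s i := by
    intro n
    induction n with
    | zero => exact ⟨hT.some, hT.some_mem, fun t _ => Or.inr (by simp)⟩
    | succ n ih =>
      obtain ⟨s, hs, hmax⟩ := ih
      have extend : ∀ t u : W2, (∀ i < n, t i = u i) → t n = u n →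
          ∀ i < n + 1, t i = u i := fun t u h1 h2 i hi =>
        (Nat.lt_succ_iff_lt_or_eq.1 hi).elim (h1 i) fun hi => hi ▸ h2
      by_cases hu : ∃ u ∈ T, ¬ le u s ∧ (∀ i < n, u i = s i) ∧ u n ≠ s n
      · obtain ⟨u, hu, hus, hagree, hne⟩ := hu
        have hsu : le s u := (h.total _ _).resolve_left hus
        refine ⟨u, hu, fun t ht => ?_⟩
        rcases hmax t ht with hts | hts
        · exact Or.inl (h.trans _ _ _ hts hsu)
        by_cases htn : t n = u n
        · exact Or.inr (extend _ _ (fun i hi => (hts i hi).trans (hagree i hi).symm) htn)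
        · have hts' : t n = s n :=
            (by decide : ∀ a b c : Bool, ¬ a = b → b ≠ c → a = c) _ _ _ htn hne
          exact Or.inl (h.le_of_agree (fun i hi => (hagree i hi).symm) hne.symm
            (fun i hi => extend _ _ hts hts' i (by omega)) (fun _ _ => rfl) hsu)
      · refine ⟨s, hs, fun t ht => ?_⟩
        rcases hmax t ht with hts | hts
        · exact Or.inl hts
        by_cases htn : t n = s n
        · exact Or.inr (extend _ _ hts htn)
        · exact Or.inl (by_contra fun hc => hu ⟨t, ht, hc, hts, htn⟩)
  choose s hs hmax using step
  have coherent : ∀ m n, m ≤ n → ∀ i < m, s n i = s m i := by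
    intro m n hmn
    rcases hmax m (s n) (hs n) with h1 | h1
    · rcases hmax n (s m) (hs m) with h2 | h2
      · intro i _
        rw [h.antisymm _ _ h1 h2]
      · exact fun i hi => (h2 i (by omega)).symm
    · exact h1
  let b : W2 := fun n => s (n + 1) n
  have hb : ∀ n, ∀ i < n, s n i = b i := fun n i hi => coherent (i + 1) n hi i (by omega)
  refine ⟨b, fun t ht => ?_, fun n => ⟨s n, hs n, hb n⟩⟩
  by_contra hc
  obtain ⟨n, hn⟩ := h.exists_not_le_of_agree hc
  have hst : ∀ i < n, t i = s n i :=
    (hmax n t ht).resolve_left (hn _ _ (fun _ _ => rfl) (hb n))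
  exact hn b b (fun i hi => ((hst i hi).trans (hb n i hi)).symm) (fun _ _ => rfl) (h.refl b)

lemma mem_supWords_iff {m : W2} : m ∈ supWords le ↔ ∀ n, le (shiftn m n) m := by
  constructor
  · rintro ⟨a, hub, hlub⟩ n
    obtain ⟨b, hb, hclosure⟩ := h.exists_upperBound_mem_closure (T := tails a) ⟨a, 0, rfl⟩
    have hbm : le b m := by
      by_contra hc
      obtain ⟨n, hn⟩ := h.exists_not_le_of_agree hc
      obtain ⟨t, ht, htb⟩ := hclosure n
      exact hn t m htb (fun _ _ => rfl) (hub t ht)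
    obtain rfl := h.antisymm _ _ (hlub b hb) hbm
    by_contra hc
    obtain ⟨p, hp⟩ := h.exists_not_le_of_agree hc
    obtain ⟨t, ⟨l, rfl⟩, ht⟩ := hclosure (p + n)
    refine hp (shiftn (shiftn a l) n) m (fun i hi => ht (i + n) (by omega)) (fun _ _ => rfl)
      (hub _ ⟨l + n, shiftn_shiftn a l n⟩)
  · intro hm
    refine ⟨m, ?_, fun b hb => hb m ⟨0, rfl⟩⟩
    rintro - ⟨n, rfl⟩
    exact hm n

lemma mem_supWords_of_isAccPt' {m : W2} (hm : IsAccPt' (supWords le) m) : m ∈ supWords le := by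
  rw [h.mem_supWords_iff]
  intro n
  by_contra hc
  obtain ⟨p, hp⟩ := h.exists_not_le_of_agree hc
  obtain ⟨y, hy, -, hym⟩ := isAccPt'_iff.1 hm (p + n)
  exact hp (shiftn y n) y (fun i hi => (hym (i + n) (by omega)).symm)
    (fun i hi => (hym i (by omega)).symm) (h.mem_supWords_iff.1 hy n)

lemma pullback (hjk : j < k) : IsPrefixOrder (pullback (tauS j k) le) where
  total a b := h.total _ _
  antisymm a b hab hba := subApply_tauS_injective hjk (h.antisymm _ _ hab hba)
  trans a b c := h.trans _ _ _
  prefix_le l a b a' b' hab ha hb hle := by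
    obtain ⟨u, hu, hua⟩ := exists_subApply_tauS_eq_block hjk a
    obtain ⟨v, hv, hvb⟩ := exists_subApply_tauS_eq_block hjk b
    obtain ⟨u', hu', hua'⟩ := exists_subApply_tauS_eq_block hjk a'
    obtain ⟨v', hv', hvb'⟩ := exists_subApply_tauS_eq_block hjk b'
    rw [_root_.pullback] at hle ⊢
    rw [subApply_prepend (tauS_ne_nil j k), subApply_prepend (tauS_ne_nil j k)] at hle ⊢
    rw [hua, hvb, block, block, ← prepend_append, ← prepend_append] at hle
    rw [hua', hvb', block, block, ← prepend_append, ← prepend_append]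
    refine h.prefix_le _ u v u' v' ?_ ?_ ?_ hle
    · rw [hu, hv]
      exact fun heq => hab (Bool.not_inj heq)
    · rw [hu, hu', ha]
    · rw [hv, hv', hb]

lemma block_le_block_iff {i : ℕ} {a b : W2} (ha : a 0 = true) (hb : b 0 = false) :
    le (block i a) (block i b) ↔ IsAscending le i :=
  ⟨h.prefix_le _ _ _ w1 w0 (by simp [ha, hb]) (by simp [ha, w1]) (by simp [hb, w0]),
    h.prefix_le _ w1 w0 _ _ (by simp [w1, w0]) (by simp [ha, w1]) (by simp [hb, w0])⟩

lemma block_le_block_iff_of_lt {i j : ℕ} (hij : i < j) {a : W2} (b : W2) (ha : a 0 = true) :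
    le (block i a) (block j b) ↔ IsAscending le i := by
  obtain ⟨c, hc, hbc⟩ := exists_block_of_lt hij b
  rw [hbc, h.block_le_block_iff ha hc]

lemma block_le_w10inf_iff {i : ℕ} {a : W2} (ha : a 0 = true) :
    le (block i a) w10inf ↔ IsAscending le i := by
  rw [← block_w0 i, h.block_le_block_iff ha rfl]

lemma le_of_head (h01 : wlt le w0 w1) {a b : W2} (ha : a 0 = false) (hb : b 0 = true) :
    le a b :=
  h.prefix_le [] w0 w1 a b (by simp [w0, w1]) (by simp [ha, w0]) (by simp [hb, w1]) h01.1

lemma wlt_pullback (hjk : j < k) (hj : IsAscending le j) :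
    wlt (_root_.pullback (tauS j k) le) w0 w1 := by
  refine ⟨?_, fun heq => by simpa [w0, w1] using congrFun heq 0⟩
  rw [_root_.pullback, subApply_tauS_false (a := w0) rfl, subApply_tauS_true (a := w1) rfl]
  exact (h.block_le_block_iff_of_lt hjk _ (subApply_tauS_zero _ _ _)).2 hj

lemma mem_supWords_pullback_iff (h01 : wlt le w0 w1) (hjk : j < k) {a : W2} :
    a ∈ supWords (_root_.pullback (tauS j k) le) ↔ subApply (tauS j k) a ∈ supWords le := by
  rw [h.mem_supWords_iff, (h.pullback hjk).mem_supWords_iff]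
  constructor
  · intro ha n
    rcases shiftn_subApply_tauS j k a n with h0 | ⟨m, hm⟩
    · exact h.le_of_head h01 h0 (subApply_tauS_zero _ _ _)
    · rw [hm]
      exact ha m
  · intro ha n
    obtain ⟨m, hm⟩ := exists_shiftn_subApply (tauS_ne_nil j k) a n
    rw [_root_.pullback, ← hm]
    exact ha m

lemma w0_mem_supWords : w0 ∈ supWords le :=
  h.mem_supWords_iff.2 fun _ => h.refl w0

lemma perW_block_mem_supWords (h01 : wlt le w0 w1) (i : ℕ) :
    perW (true :: List.replicate i false) ∈ supWords le := by
  have hi := subApply_perW (tauS_ne_nil i (i + 1)) (w := [false]) (by simp)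
  rw [perW_false] at hi
  have hw : listApply (tauS i (i + 1)) [false] = true :: List.replicate i false := by
    simp [listApply, tauS]
  rw [← hw, ← hi, ← h.mem_supWords_pullback_iff h01 (Nat.lt_succ_self i)]
  exact (h.pullback (Nat.lt_succ_self i)).w0_mem_supWords

lemma isAccPt'_w10inf (h01 : wlt le w0 w1) : IsAccPt' (supWords le) w10inf := by
  refine isAccPt'_iff.2 fun n => ⟨_, h.perW_block_mem_supWords h01 n, ?_, fun i hi => ?_⟩
  · rw [perW_block_eq_block]
    exact block_ne_w10inf rfl
  · rw [← block_w0 n, perW_block_eq_block]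
    exact prepend_congr fun q hq => by simp at hq; omega

lemma isAccPt'_subApply (h01 : wlt le w0 w1) (hjk : j < k) {z : W2}
    (hz : IsAccPt' (supWords (_root_.pullback (tauS j k) le)) z) :
    IsAccPt' (supWords le) (subApply (tauS j k) z) := by
  refine isAccPt'_iff.2 fun n => ?_
  obtain ⟨y, hy, hyz, hagree⟩ := isAccPt'_iff.1 hz n
  exact ⟨_, (h.mem_supWords_pullback_iff h01 hjk).1 hy,
    (subApply_tauS_injective hjk).ne hyz,
    fun i hi => subApply_tauS_congr hjk hagree i (by omega)⟩

lemma isAccPt'_subApply_w10inf (h01 : wlt le w0 w1) (hjk : j < k) (hj : IsAscending le j) :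
    IsAccPt' (supWords le) (subApply (tauS j k) w10inf) :=
  h.isAccPt'_subApply h01 hjk ((h.pullback hjk).isAccPt'_w10inf (h.wlt_pullback hjk hj))

lemma eq_w0_of_mem_supWords (h01 : wlt le w0 w1) {a : W2} (ha : a ∈ supWords le)
    (ha0 : a 0 = false) : a = w0 := by
  funext n
  by_contra hn
  have htail : shiftn a n 0 = true := by simpa [shiftn, w0] using hn
  have heq := h.antisymm _ _ (h.mem_supWords_iff.1 ha n) (h.le_of_head h01 ha0 htail)
  rw [heq, ha0] at htail
  exact Bool.false_ne_true htail

/-- If no block other than `10^j` is below `10^k` in the order on blocks, then a word starting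
with `1` and bounded by a word of the form `10^k1⋯` starts with `10^j1` or `10^k1`. -/
lemma exists_prepend_tauS_of_le (hk : IsAscending le k)
    (honly : ∀ i < k, IsAscending le i → i = j) {t y : W2} (ht : t 0 = true) (hy : y 0 = true)
    (hle : le t (block k y)) : ∃ b u, u 0 = true ∧ t = prepend (tauS j k b) u := by
  rcases eq_w10inf_or_block ht with rfl | ⟨i, u, hu, rfl⟩
  · exact absurd (h.antisymm _ _ ((h.block_le_w10inf_iff hy).2 hk) hle) (block_ne_w10inf hy)
  rcases lt_trichotomy i k with hik | rfl | hik
  · obtain rfl := honly i hik ((h.block_le_block_iff_of_lt hik y hu).1 hle)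
    exact ⟨false, u, hu, rfl⟩
  · exact ⟨true, u, hu, rfl⟩
  · exact absurd (h.antisymm _ _ ((h.block_le_block_iff_of_lt hik u hy).2 hk) hle)
      (block_ne_block_of_lt hik hy)

lemma exists_eq_subApply_of_le (hk : IsAscending le k)
    (honly : ∀ i < k, IsAscending le i → i = j) {a y : W2} (ha : a ∈ supWords le)
    (ha0 : a 0 = true) (hy : y 0 = true) (hle : le a (block k y)) :
    ∃ a', a = subApply (tauS j k) a' := by
  refine exists_eq_subApply (tauS_ne_nil j k) (P := fun t => t 0 = true ∧ ∃ n, t = shiftn a n)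
    ?_ ⟨ha0, 0, rfl⟩
  rintro - ⟨ht, n, rfl⟩
  obtain ⟨b, u, hu, htu⟩ := h.exists_prepend_tauS_of_le hk honly ht hy
    (h.trans _ _ _ (h.mem_supWords_iff.1 ha n) hle)
  refine ⟨b, u, htu, hu, n + (tauS j k b).length, ?_⟩
  rw [← shiftn_shiftn, htu]
  exact (shiftn_prepend _ u 0).symm

lemma eq_of_isAscending_of_isSmallestAcc (h01 : wlt le w0 w1)
    (hm : IsSmallestAcc le (supWords le) w10inf) {i j : ℕ} (hi : IsAscending le i)
    (hj : IsAscending le j) : i = j := by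
  by_contra hij
  wlog hlt : i < j generalizing i j
  · exact this hj hi (Ne.symm hij) (by omega)
  have hle := hm.2 _ (h.isAccPt'_subApply_w10inf h01 hlt hi)
  rw [subApply_tauS_true (a := w10inf) rfl] at hle
  have h0 := subApply_tauS_zero i j (shiftn w10inf 1)
  exact block_ne_w10inf h0 (h.antisymm _ _ ((h.block_le_w10inf_iff h0).2 hj) hle)

lemma wlt_perW_w10inf_iff (i : ℕ) :
    wlt le (perW (true :: List.replicate i false)) w10inf ↔ IsAscending le i := by
  have h0 : perW (true :: List.replicate i false) 0 = true := by
    rw [perW_block_eq_block]; rfl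
  rw [wlt, perW_block_eq_block, h.block_le_w10inf_iff h0]
  exact and_iff_left (block_ne_w10inf h0)

lemma mem_supWords_and_wlt_w10inf_iff (h01 : wlt le w0 w1)
    (hm : IsSmallestAcc le (supWords le) w10inf) (a : W2) :
    (a ∈ supWords le ∧ wlt le a w10inf) ↔
      a = w0 ∨ ∃ i, a = perW (true :: List.replicate i false) ∧ wlt le a w10inf := by
  constructor
  · rintro ⟨ha, hlt⟩
    cases ha0 : a 0 with
    | false => exact Or.inl (h.eq_w0_of_mem_supWords h01 ha ha0)
    | true =>
      right
      have step : ∀ n, shiftn a n 0 = true →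
          ∃ i u, u 0 = true ∧ shiftn a n = block i u ∧ IsAscending le i := by
        intro n hn
        have hle := h.mem_supWords_iff.1 ha n
        rcases eq_w10inf_or_block hn with h1 | ⟨i, u, hu, h1⟩
        · rw [h1] at hle
          exact absurd (h.antisymm _ _ hlt.1 hle) hlt.2
        · exact ⟨i, u, hu, h1, (h.block_le_w10inf_iff hu).1 (h1 ▸ h.trans _ _ _ hle hlt.1)⟩
      obtain ⟨i, -, -, -, hi⟩ := step 0 ha0
      refine ⟨i, eq_of_forall_eq_prepend (w := true :: List.replicate i false) (by simp)
        (perW_eq_prepend _) (P := fun t => t 0 = true ∧ ∃ n, t = shiftn a n) ?_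
        ⟨ha0, 0, rfl⟩, hlt⟩
      rintro - ⟨ht, n, rfl⟩
      obtain ⟨i', u, hu, htu, hi'⟩ := step n ht
      obtain rfl := h.eq_of_isAscending_of_isSmallestAcc h01 hm hi hi'
      refine ⟨u, htu, hu, n + (i + 1), ?_⟩
      rw [← shiftn_shiftn, htu, shiftn_block]
  · rintro (rfl | ⟨i, rfl, hlt⟩)
    · exact ⟨h.w0_mem_supWords, h.le_of_head h01 rfl rfl,
        fun heq => by simpa [w0, w10inf] using congrFun heq 0⟩
    · exact ⟨h.perW_block_mem_supWords h01 i, hlt⟩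

/-- `10^j` and `10^k` are the two smallest blocks if `m_≤` is the image of a word `x = 1⋯` with
at least one `0` under `τ_{j,k}`. -/
lemma isAscending_of_isSmallestAcc (h01 : wlt le w0 w1) (hjk : j < k) {x : W2}
    (hx0 : x 0 = true) {p : ℕ} (hxp : x p = false)
    (hm : IsSmallestAcc le (supWords le) (subApply (tauS j k) x)) :
    IsAscending le j ∧ IsAscending le k ∧ ∀ i < k, IsAscending le i → i = j := by
  have h0 := subApply_tauS_zero j k (shiftn x 1)
  have hk : IsAscending le k := by
    have := hm.2 _ (h.isAccPt'_w10inf h01)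
    rwa [subApply_tauS_true hx0, h.block_le_w10inf_iff h0] at this
  have hj : IsAscending le j := by
    obtain ⟨n, hn⟩ := exists_shiftn_subApply (tauS_ne_nil j k) x p
    have := h.mem_supWords_iff.1 (h.mem_supWords_of_isAccPt' hm.1) n
    rwa [hn, subApply_tauS_true hx0, subApply_tauS_false (a := shiftn x p) (by simpa [shiftn]),
      h.block_le_block_iff_of_lt hjk _ (subApply_tauS_zero _ _ _)] at this
  have hcontra : ∀ i i', i < i' → i' < k → IsAscending le i → IsAscending le i' → False := by
    intro i i' hii' hik hi hi'
    have hle := hm.2 _ (h.isAccPt'_subApply_w10inf h01 hii' hi)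
    rw [subApply_tauS_true hx0, subApply_tauS_true (a := w10inf) rfl] at hle
    have h0' := subApply_tauS_zero i i' (shiftn w10inf 1)
    exact block_ne_block_of_lt hik h0'
      (h.antisymm _ _ ((h.block_le_block_iff_of_lt hik _ h0').2 hi') hle)
  refine ⟨hj, hk, fun i hik hi => ?_⟩
  rcases lt_trichotomy i j with hij | hij | hij
  · exact (hcontra i j hij hjk hi hj).elim
  · exact hij
  · exact (hcontra j i hij hik hj hi).elim

lemma isSmallestAcc_pullback (h01 : wlt le w0 w1) (hjk : j < k) {x : W2}
    (hx0 : x 0 = true) {p : ℕ} (hxp : x p = false)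
    (hm : IsSmallestAcc le (supWords le) (subApply (tauS j k) x)) :
    IsSmallestAcc (_root_.pullback (tauS j k) le) (supWords (_root_.pullback (tauS j k) le))
      x := by
  obtain ⟨hj, hk, honly⟩ := h.isAscending_of_isSmallestAcc h01 hjk hx0 hxp hm
  refine ⟨isAccPt'_iff.2 fun n => ?_, fun z hz => hm.2 _ (h.isAccPt'_subApply h01 hjk hz)⟩
  obtain ⟨y, hy, hyx, hagree⟩ := isAccPt'_iff.1 hm.1 ((k + 1) * n + k + 2)
  have hxk := subApply_tauS_true (j := j) (k := k) hx0
  have hyk : y = block k (shiftn y (k + 1)) :=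
    eq_block_of_agree fun i hi => by rw [← hagree i (by omega), hxk]
  have hy1 : shiftn y (k + 1) 0 = true := by
    have : shiftn (subApply (tauS j k) x) (k + 1) 0 = shiftn y (k + 1) 0 :=
      hagree (0 + (k + 1)) (by omega)
    rw [← this, hxk, shiftn_block, subApply_tauS_zero]
  obtain ⟨y', rfl⟩ := h.exists_eq_subApply_of_le hk honly hy (by rw [hyk]; rfl) hy1
    (by rw [← hyk]; exact h.refl _)
  refine ⟨y', (h.mem_supWords_pullback_iff h01 hjk).2 hy, fun heq => hyx (by rw [heq]), ?_⟩
  obtain ⟨q, hq, hne⟩ := exists_first_ne fun heq : x = y' => hyx (by rw [heq])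
  suffices n ≤ q from fun i hi => hq i (by omega)
  by_contra! hqn
  obtain ⟨l, hl, hxl, hyl⟩ := exists_eq_prepend_of_agree hq
  obtain ⟨u, hu, hxu⟩ := exists_subApply_tauS_eq_block hjk (shiftn x q)
  obtain ⟨v, hv, hyv⟩ := exists_subApply_tauS_eq_block hjk (shiftn y' q)
  have hlen := length_listApply_tauS_le hjk l
  have hmul := Nat.mul_le_mul_left (k + 1) hqn.le
  have hpos := hagree ((listApply (tauS j k) l).length + (j + 1)) (by rw [hl] at hlen; omega)
  rw [hxl, hyl, subApply_prepend (tauS_ne_nil j k), subApply_prepend (tauS_ne_nil j k),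
    prepend_length_add, prepend_length_add, hxu, hyv] at hpos
  have hhead : ∀ w : W2, block j w (j + 1) = w 0 := fun w => by
    conv_rhs => rw [← shiftn_block j w]
    simp [shiftn]
  rw [hhead, hhead, hu, hv] at hpos
  exact hne (by simpa [shiftn] using Bool.not_inj hpos)

lemma mem_supWords_and_wlt_subApply_iff (h01 : wlt le w0 w1) (hjk : j < k) {x : W2}
    (hx0 : x 0 = true) {p : ℕ} (hxp : x p = false)
    (hm : IsSmallestAcc le (supWords le) (subApply (tauS j k) x)) (a : W2) :
    (a ∈ supWords le ∧ wlt le a (subApply (tauS j k) x)) ↔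
      a = w0 ∨ ∃ a', a = subApply (tauS j k) a' ∧
        a' ∈ supWords (_root_.pullback (tauS j k) le) ∧
          wlt (_root_.pullback (tauS j k) le) a' x := by
  obtain ⟨-, hk, honly⟩ := h.isAscending_of_isSmallestAcc h01 hjk hx0 hxp hm
  constructor
  · rintro ⟨ha, hlt⟩
    cases ha0 : a 0 with
    | false => exact Or.inl (h.eq_w0_of_mem_supWords h01 ha ha0)
    | true =>
      obtain ⟨a', rfl⟩ := h.exists_eq_subApply_of_le hk honly ha ha0
        (subApply_tauS_zero j k (shiftn x 1)) (by rw [← subApply_tauS_true hx0]; exact hlt.1)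
      exact Or.inr ⟨a', rfl, (h.mem_supWords_pullback_iff h01 hjk).2 ha, hlt.1,
        fun heq => hlt.2 (by rw [heq])⟩
  · rintro (rfl | ⟨a', rfl, ha', hlt⟩)
    · exact ⟨h.w0_mem_supWords, h.le_of_head h01 rfl (subApply_tauS_zero _ _ _),
        fun heq => by simpa [w0] using congrFun heq 0⟩
    · exact ⟨(h.mem_supWords_pullback_iff h01 hjk).1 ha', hlt.1,
        (subApply_tauS_injective hjk).ne hlt.2⟩

end IsPrefixOrder

end Orders

section Finite

variable {L : List Sub2}

lemma applyList_w10inf_zero (hL : ∀ f ∈ L, memS f) : applyList L w10inf 0 = true := by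
  cases L with
  | nil => rfl
  | cons f L =>
    obtain ⟨j, k, -, rfl⟩ := hL f (by simp)
    exact subApply_tauS_zero j k (applyList L w10inf)

lemma applyList_w10inf_one (hL : ∀ f ∈ L, memS f) : applyList L w10inf 1 = false := by
  cases L with
  | nil => rfl
  | cons f L =>
    obtain ⟨j, k, hjk, rfl⟩ := hL f (by simp)
    exact subApply_tauS_one hjk (applyList_w10inf_zero fun g hg => hL g (by simp [hg]))

lemma wlt_pullback_iff {le : W2 → W2 → Prop} {j k : ℕ} (hjk : j < k) {a b : W2} :
    wlt (pullback (tauS j k) le) a b ↔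
      wlt le (subApply (tauS j k) a) (subApply (tauS j k) b) := by
  rw [wlt, wlt, (subApply_tauS_injective hjk).ne_iff]
  rfl

lemma perW_listApplyL_cons {f : Sub2} (hf : memS f) (hL : ∀ g ∈ L, memS g) :
    perW (listApplyL (f :: L) [false]) = subApply f (perW (listApplyL L [false])) :=
  (subApply_perW hf.ne_nil
    (listApplyL_ne_nil (fun g hg => (hL g hg).ne_nil) (by simp))).symm

theorem mem_supWords_and_wlt_applyList_iff {le : W2 → W2 → Prop} (h : IsPrefixOrder le)
    (h01 : wlt le w0 w1) (hL : ∀ f ∈ L, memS f)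
    (hm : IsSmallestAcc le (supWords le) (applyList L w10inf)) :
    (∀ a, (a ∈ supWords le ∧ wlt le a (applyList L w10inf)) ↔
      (∃ n ≤ L.length, a = perW (listApplyL (L.take n) [false])) ∨
      ∃ j : ℕ, a = applyList L (perW (true :: List.replicate j false)) ∧
        wlt le a (applyList L w10inf)) ∧
    ∀ i j : ℕ,
      wlt le (applyList L (perW (true :: List.replicate i false))) (applyList L w10inf) →
      wlt le (applyList L (perW (true :: List.replicate j false))) (applyList L w10inf) →
      i = j := by
  induction L generalizing le with
  | nil =>
    refine ⟨fun a => ?_, fun i j hi hj => ?_⟩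
    · refine (h.mem_supWords_and_wlt_w10inf_iff h01 hm a).trans (or_congr_left ?_)
      simp [listApplyL, perW_false]
    · exact h.eq_of_isAscending_of_isSmallestAcc h01 hm ((h.wlt_perW_w10inf_iff i).1 hi)
        ((h.wlt_perW_w10inf_iff j).1 hj)
  | cons f L ih =>
    have hf := hL f (by simp)
    have hL' : ∀ g ∈ L, memS g := fun g hg => hL g (by simp [hg])
    obtain ⟨j, k, hjk, rfl⟩ := hf
    have hx0 := applyList_w10inf_zero hL'
    have hx1 := applyList_w10inf_one hL'
    obtain ⟨hj, -, -⟩ := h.isAscending_of_isSmallestAcc h01 hjk hx0 hx1 hm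
    obtain ⟨ih1, ih2⟩ := ih (h.pullback hjk) (h.wlt_pullback hjk hj) hL'
      (h.isSmallestAcc_pullback h01 hjk hx0 hx1 hm)
    refine ⟨fun a => (h.mem_supWords_and_wlt_subApply_iff h01 hjk hx0 hx1 hm a).trans ?_,
      fun i i' hi hi' => ih2 i i' ((wlt_pullback_iff hjk).2 hi) ((wlt_pullback_iff hjk).2 hi')⟩
    have htake : ∀ n, perW (listApplyL ((tauS j k :: L).take (n + 1)) [false]) =
        subApply (tauS j k) (perW (listApplyL (L.take n) [false])) := fun n =>
      perW_listApplyL_cons ⟨j, k, hjk, rfl⟩ fun g hg => hL' g (List.mem_of_mem_take hg)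
    constructor
    · rintro (rfl | ⟨a', rfl, ha'⟩)
      · exact Or.inl ⟨0, by simp, perW_false.symm⟩
      · rcases (ih1 a').1 ha' with ⟨n, hn, rfl⟩ | ⟨i, rfl, hlt⟩
        · exact Or.inl ⟨n + 1, by simpa using hn, (htake n).symm⟩
        · exact Or.inr ⟨i, rfl, (wlt_pullback_iff hjk).1 hlt⟩
    · rintro (⟨n, hn, rfl⟩ | ⟨i, rfl, hlt⟩)
      · cases n with
        | zero => exact Or.inl perW_false
        | succ n =>
          exact Or.inr ⟨_, htake n, (ih1 _).2 (Or.inl ⟨n, by simpa using hn, rfl⟩)⟩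
      · exact Or.inr ⟨_, rfl, (ih1 _).2 (Or.inr ⟨i, rfl, (wlt_pullback_iff hjk).2 hlt⟩)⟩

end Finite

section Limit

/-- The limit word of the directive sequence `σ`, read off diagonally. -/
def limitWord (σ : ℕ → Sub2) : W2 := fun i => compUpTo σ i w1 i

variable {σ : ℕ → Sub2}

lemma compUpTo_succ (σ : ℕ → Sub2) (n : ℕ) (a : W2) :
    compUpTo σ (n + 1) a = subApply (σ 0) (compUpTo (fun i => σ (i + 1)) n a) := by
  rw [compUpTo, List.ofFn_succ]
  rfl

lemma compUpTo_zero_eq_true (hσ : ∀ n, memS (σ n)) (n : ℕ) : compUpTo σ n w1 0 = true := by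
  cases n with
  | zero => rfl
  | succ n =>
    obtain ⟨j, k, -, h0⟩ := hσ 0
    rw [compUpTo_succ, h0, subApply_tauS_zero]

lemma compUpTo_succ_agree (hσ : ∀ n, memS (σ n)) (n : ℕ) :
    ∀ i ≤ n, compUpTo σ n w1 i = compUpTo σ (n + 1) w1 i := by
  induction n generalizing σ with
  | zero =>
    intro i hi
    obtain rfl := Nat.le_zero.1 hi
    rw [compUpTo_zero_eq_true hσ, compUpTo_zero_eq_true hσ]
  | succ n ih =>
    intro i hi
    have hσ' : ∀ n, memS (σ (n + 1)) := fun n => hσ (n + 1)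
    obtain ⟨j, k, hjk, h0⟩ := hσ 0
    rw [compUpTo_succ σ n, compUpTo_succ σ (n + 1), h0]
    refine subApply_tauS_congr hjk (n := n + 1) (fun i hi => ih hσ' i (by omega)) i ?_
    rw [if_pos ⟨compUpTo_zero_eq_true hσ' n, by omega⟩]
    omega

lemma compUpTo_eq_limitWord (hσ : ∀ n, memS (σ n)) {i n : ℕ} (hin : i ≤ n) :
    compUpTo σ n w1 i = limitWord σ i := by
  induction n, hin using Nat.le_induction with
  | base => rfl
  | succ n hin ih => rw [← compUpTo_succ_agree hσ n i hin, ih]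

lemma IsLimitWord.eq_limitWord (hσ : ∀ n, memS (σ n)) {m : W2} (hm : IsLimitWord σ w1 m) :
    m = limitWord σ := by
  funext i
  obtain ⟨N, hN⟩ := hm ((2 : ℝ)⁻¹ ^ (i + 1)) (by positivity)
  have := (wdist_lt_iff _ _ _).1 (hN (max N i) (le_max_left _ _)) i (Nat.lt_succ_self i)
  rw [← this, compUpTo_eq_limitWord hσ (le_max_right _ _)]

lemma limitWord_zero (σ : ℕ → Sub2) : limitWord σ 0 = true := rfl

lemma limitWord_eq_subApply (hσ : ∀ n, memS (σ n)) :
    limitWord σ = subApply (σ 0) (limitWord fun i => σ (i + 1)) := by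
  funext i
  rw [← compUpTo_eq_limitWord hσ (Nat.le_succ i), compUpTo_succ]
  obtain ⟨j, k, hjk, h0⟩ := hσ 0
  rw [h0]
  exact subApply_tauS_congr hjk (n := i + 1)
    (fun q hq => compUpTo_eq_limitWord (fun n => hσ (n + 1)) (by omega)) i (by omega)

lemma limitWord_one (hσ : ∀ n, memS (σ n)) : limitWord σ 1 = false := by
  obtain ⟨j, k, hjk, h0⟩ := hσ 0
  rw [limitWord_eq_subApply hσ, h0]
  exact subApply_tauS_one hjk (limitWord_zero _)

lemma perW_listApplyL_ofFn_succ (hσ : ∀ n, memS (σ n)) (n : ℕ) :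
    perW (listApplyL (List.ofFn fun i : Fin (n + 1) => σ i.val) [false]) =
      subApply (σ 0) (perW (listApplyL (List.ofFn fun i : Fin n => σ (i.val + 1)) [false])) := by
  rw [List.ofFn_succ]
  refine perW_listApplyL_cons (hσ 0) fun g hg => ?_
  obtain ⟨i, rfl⟩ := List.mem_ofFn.1 hg
  exact hσ _

variable {le : W2 → W2 → Prop}

/-- One renormalization step for the words of `supWords le` below the limit word. -/
lemma mem_supWords_and_wlt_limitWord_step (h : IsPrefixOrder le) (h01 : wlt le w0 w1)
    (hσ : ∀ n, memS (σ n)) (hm : IsSmallestAcc le (supWords le) (limitWord σ)) :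
    ∃ le' : W2 → W2 → Prop, IsPrefixOrder le' ∧ wlt le' w0 w1 ∧
      IsSmallestAcc le' (supWords le') (limitWord fun i => σ (i + 1)) ∧
      ∀ a, (a ∈ supWords le ∧ wlt le a (limitWord σ)) ↔ a = w0 ∨
        ∃ a', a = subApply (σ 0) a' ∧ a' ∈ supWords le' ∧
          wlt le' a' (limitWord fun i => σ (i + 1)) := by
  have hx1 := limitWord_one fun n => hσ (n + 1)
  obtain ⟨j, k, hjk, h0⟩ := hσ 0
  rw [limitWord_eq_subApply hσ, h0] at hm ⊢
  obtain ⟨hj, -, -⟩ := h.isAscending_of_isSmallestAcc h01 hjk (limitWord_zero _) hx1 hm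
  exact ⟨_, h.pullback hjk, h.wlt_pullback hjk hj,
    h.isSmallestAcc_pullback h01 hjk (limitWord_zero _) hx1 hm,
    h.mem_supWords_and_wlt_subApply_iff h01 hjk (limitWord_zero _) hx1 hm⟩

theorem mem_supWords_and_wlt_limitWord_iff (h : IsPrefixOrder le) (h01 : wlt le w0 w1)
    (hσ : ∀ n, memS (σ n)) (hm : IsSmallestAcc le (supWords le) (limitWord σ)) (a : W2) :
    (a ∈ supWords le ∧ wlt le a (limitWord σ)) ↔
      ∃ n : ℕ, a = perW (listApplyL (List.ofFn fun i : Fin n => σ i.val) [false]) := by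
  constructor
  · rintro ⟨ha, hlt⟩
    obtain ⟨p, hp⟩ := Function.ne_iff.1 hlt.2
    induction p using Nat.strong_induction_on generalizing le σ a with
    | _ p ih =>
      obtain ⟨le', h', h01', hm', hiff⟩ := mem_supWords_and_wlt_limitWord_step h h01 hσ hm
      rcases (hiff a).1 ⟨ha, hlt⟩ with rfl | ⟨a', rfl, ha', hlt'⟩
      · exact ⟨0, perW_false.symm⟩
      have hσ' : ∀ n, memS (σ (n + 1)) := fun n => hσ (n + 1)
      cases ha0 : a' 0 with
      | false =>
        refine ⟨1, ?_⟩
        rw [perW_listApplyL_ofFn_succ hσ, h'.eq_w0_of_mem_supWords h01' ha' ha0, ← perW_false]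
        rfl
      | true =>
        obtain ⟨q, hqp, hq⟩ : ∃ q < p, a' q ≠ limitWord (fun i => σ (i + 1)) q := by
          by_contra! hc
          obtain ⟨j, k, hjk, h0⟩ := hσ 0
          rw [limitWord_eq_subApply hσ, h0] at hp
          have hp0 : 0 < p := by
            rw [Nat.pos_iff_ne_zero]
            rintro rfl
            simp at hp
          exact hp (subApply_tauS_congr hjk hc p (by rw [if_pos ⟨ha0, hp0⟩]; omega))
        obtain ⟨n, hn⟩ := ih q hqp h' h01' hσ' hm' a' ha' hlt' hq
        exact ⟨n + 1, by rw [perW_listApplyL_ofFn_succ hσ, hn]⟩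
  · rintro ⟨n, rfl⟩
    induction n generalizing le σ with
    | zero =>
      obtain ⟨_, _, _, _, hiff⟩ := mem_supWords_and_wlt_limitWord_step h h01 hσ hm
      exact (hiff _).2 (Or.inl perW_false)
    | succ n ih =>
      obtain ⟨le', h', h01', hm', hiff⟩ := mem_supWords_and_wlt_limitWord_step h h01 hσ hm
      rw [perW_listApplyL_ofFn_succ hσ]
      exact (hiff _).2 (Or.inr ⟨_, rfl, ih h' h01' (fun n => hσ (n + 1)) hm'⟩)

end Limit

/-- Let `≤` be a cylinder order on `{0,1}^∞` with `0^∞ < 1^∞`.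
(i) If `m_≤ = σ(1^∞)` for `σ ∈ S^∞`, then
`{a ∈ M_≤ : a < m_≤} = {(σ_{[1,n]}(0))^∞ : n ≥ 0}`.
(ii) If `m_≤ = σ_{[1,h]}(10^∞)` with `σ_1, …, σ_h ∈ S`, then
`{a ∈ M_≤ : a < m_≤} = {(σ_{[1,n]}(0))^∞ : 0 ≤ n ≤ h} ∪
{σ_{[1,h]}((10^j)^∞) : j ≥ 0, σ_{[1,h]}((10^j)^∞) < m_≤}`, and at most one `j` occurs. -/
theorem stmt_8 (le : W2 → W2 → Prop) (h : IsCylOrder le) (h01 : wlt le w0 w1) :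
    (∀ σ : ℕ → Sub2, (∀ n, memS (σ n)) → ∀ m : W2, IsLimitWord σ w1 m →
      IsSmallestAcc le (supWords le) m →
        {a ∈ supWords le | wlt le a m} =
          {a | ∃ n : ℕ, a = perW (listApplyL (List.ofFn (fun i : Fin n => σ i.val)) [false])}) ∧
    (∀ L : List Sub2, (∀ f ∈ L, memS f) →
      IsSmallestAcc le (supWords le) (applyList L w10inf) →
        ({a ∈ supWords le | wlt le a (applyList L w10inf)} =
          {a | ∃ n ≤ L.length, a = perW (listApplyL (L.take n) [false])} ∪
          {a | ∃ j : ℕ, a = applyList L (perW (true :: List.replicate j false)) ∧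
            wlt le a (applyList L w10inf)}) ∧
        ∀ j j' : ℕ,
          wlt le (applyList L (perW (true :: List.replicate j false))) (applyList L w10inf) →
          wlt le (applyList L (perW (true :: List.replicate j' false))) (applyList L w10inf) →
          j = j') := by
  have ho := h.isPrefixOrder
  refine ⟨fun σ hσ m hlim hm => ?_, fun L hL hm => ?_⟩
  · obtain rfl := hlim.eq_limitWord hσ
    exact Set.ext (mem_supWords_and_wlt_limitWord_iff ho h01 hσ hm)
  · obtain ⟨hset, huniq⟩ := mem_supWords_and_wlt_applyList_iff ho h01 hL hm
    exact ⟨Set.ext hset, huniq⟩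
end
end

section
/- Let ≤ be any cylinder order on {0,1}^∞. Then the factor complexity of m_≤ satisfies p_{m_≤}(n) ≤ 3n − 2 for all n ≥ 2. -/
open scoped Classical

noncomputable section

/-- The set of factors of length `n` of an infinite word. -/
def factorSet (a : W2) (n : ℕ) : Set (List Bool) :=
  {l | ∃ k : ℕ, l = List.ofFn (fun i : Fin n => a (k + i.val))}

/-- The factor complexity `p_a(n)`. -/
noncomputable def complexity (a : W2) (n : ℕ) : ℕ := (factorSet a n).ncard

namespace CylinderOrder

/-- The finite word `l` is a prefix of the infinite word `a`. -/
def Pre (a : W2) (l : List Bool) : Prop := ∀ i (h : i < l.length), l[i] = a i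

/-- The prefix of length `n` of an infinite word. -/
def pfx (a : W2) (n : ℕ) : List Bool := List.ofFn fun i : Fin n => a i

theorem length_pfx (a : W2) (n : ℕ) : (pfx a n).length = n := by simp [pfx]

theorem pre_pfx (a : W2) (n : ℕ) : Pre a (pfx a n) := by
  intro i h; simp [pfx]

theorem pre_nil (a : W2) : Pre a [] := by
  intro i h; simp at h

theorem Pre.mono {a : W2} {l l' : List Bool} (h : Pre a l) (h' : l' <+: l) : Pre a l' := by
  obtain ⟨t, rfl⟩ := h'
  intro i hi
  rw [← h i (by simp; omega), List.getElem_append_left hi]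

theorem pre_append {a : W2} {u v : List Bool} :
    Pre a (u ++ v) ↔ Pre a u ∧ Pre (shiftn a u.length) v := by
  constructor
  · intro h
    refine ⟨h.mono (List.prefix_append _ _), fun i hi => ?_⟩
    have := h (i + u.length) (by simp; omega)
    rw [List.getElem_append_right (by omega)] at this
    simpa [shiftn] using this
  · rintro ⟨h1, h2⟩ i hi
    by_cases h : i < u.length
    · rw [List.getElem_append_left h, h1]
    · rw [List.getElem_append_right (by omega), h2 (i - u.length) (by simp at hi; omega)]
      simp only [shiftn]
      congr 1; omega

theorem pre_cons {a : W2} {c : Bool} {v : List Bool} :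
    Pre a (c :: v) ↔ c = a 0 ∧ Pre (shiftn a 1) v := by
  rw [← List.singleton_append, pre_append]
  simp [Pre]

theorem pre_concat {a : W2} {u : List Bool} {c : Bool} :
    Pre a (u ++ [c]) ↔ Pre a u ∧ a u.length = c := by
  rw [pre_append]
  simp [Pre, shiftn, eq_comm]

theorem Pre.prefix_of_length_le {a : W2} {u v : List Bool} (hu : Pre a u) (hv : Pre a v)
    (h : u.length ≤ v.length) : u <+: v := by
  rw [List.prefix_iff_eq_take]
  apply List.ext_getElem
  · simp; omega
  · intro i h1 h2
    rw [hu i h1, List.getElem_take, hv]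

theorem pre_of_agree {a b : W2} {P : List Bool} (h : ∀ i < P.length, a i = b i) (ha : Pre a P) :
    Pre b P := fun i hi => by rw [ha i hi, h i hi]

theorem agree_of_pre {a b : W2} {P : List Bool} (ha : Pre a P) (hb : Pre b P) :
    ∀ i < P.length, a i = b i := fun i hi => by rw [← ha i hi, ← hb i hi]

theorem exists_branch {a b : W2} (h : a ≠ b) :
    ∃ P c, Pre a (P ++ [c]) ∧ Pre b (P ++ [!c]) := by
  have h' : ∃ n, a n ≠ b n := Function.ne_iff.mp h
  refine ⟨pfx a (Nat.find h'), a (Nat.find h'), ?_, ?_⟩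
  · rw [pre_concat]
    exact ⟨pre_pfx _ _, by rw [length_pfx]⟩
  · rw [pre_concat, length_pfx]
    refine ⟨pre_of_agree (fun i hi => ?_) (pre_pfx a _), ?_⟩
    · rw [length_pfx] at hi
      exact not_not.mp (Nat.find_min h' hi)
    · have := Nat.find_spec h'
      revert this
      cases a (Nat.find h') <;> cases b (Nat.find h') <;> simp

theorem not_pre_branch {a : W2} {P : List Bool} {c : Bool} (h : Pre a (P ++ [c])) :
    ¬ Pre a (P ++ [!c]) := by
  rw [pre_concat] at *
  intro h'
  have := h.2.symm.trans h'.2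
  simp at this

theorem ne_of_branch {a b : W2} {P : List Bool} {c : Bool} (ha : Pre a (P ++ [c]))
    (hb : Pre b (P ++ [!c])) : a ≠ b := by
  rintro rfl
  exact not_pre_branch ha hb

theorem shiftn_shiftn (a : W2) (k l : ℕ) : shiftn (shiftn a k) l = shiftn a (l + k) := by
  funext n; simp [shiftn, add_assoc]

/-! ### Substitutions -/

/-- The image of a finite word under `τ_{j,k}`. -/
abbrev ap (j k : ℕ) (P : List Bool) : List Bool := listApply (tauS j k) P

/-- The image of an infinite word under `τ_{j,k}`. -/
abbrev T (j k : ℕ) (a : W2) : W2 := subApply (tauS j k) a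

theorem ap_nil (j k : ℕ) : ap j k [] = [] := rfl

theorem ap_cons (j k : ℕ) (c : Bool) (P : List Bool) :
    ap j k (c :: P) = true :: (List.replicate (if c then k else j) false ++ ap j k P) := by
  simp [ap, listApply, tauS]

theorem ap_append (j k : ℕ) (P Q : List Bool) : ap j k (P ++ Q) = ap j k P ++ ap j k Q := by
  simp [ap, listApply]

theorem ap_isPrefix (j k : ℕ) {P Q : List Bool} (h : P <+: Q) : ap j k P <+: ap j k Q := by
  obtain ⟨t, rfl⟩ := h
  rw [ap_append]
  exact List.prefix_append _ _

theorem length_le_length_ap (j k : ℕ) (P : List Bool) : P.length ≤ (ap j k P).length := by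
  induction P with
  | nil => simp
  | cons c P ih => rw [ap_cons]; simp; omega

theorem pre_T {j k : ℕ} {a : W2} {P : List Bool} (h : Pre a P) : Pre (T j k a) (ap j k P) := by
  intro i hi
  have hn : i < (ap j k (pfx a (i + 1))).length := by
    have := length_le_length_ap j k (pfx a (i + 1))
    rw [length_pfx] at this
    omega
  have h2 : T j k a i = (ap j k (pfx a (i + 1)))[i] := by
    simp only [T, subApply]
    exact List.getD_eq_getElem _ _ hn
  rw [h2]
  rcases le_total P.length (i + 1) with hl | hl
  · exact (ap_isPrefix j k (h.prefix_of_length_le (pre_pfx a (i + 1))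
      (by rwa [length_pfx]))).getElem hi
  · exact ((ap_isPrefix j k ((pre_pfx a (i + 1)).prefix_of_length_le h
      (by rwa [length_pfx]))).getElem hn).symm

theorem eq_T_of_pre {j k : ℕ} {a y : W2} (h : ∀ P, Pre a P → Pre y (ap j k P)) : y = T j k a := by
  funext n
  have hn : n < (ap j k (pfx a (n + 1))).length := by
    have := length_le_length_ap j k (pfx a (n + 1))
    rw [length_pfx] at this
    omega
  rw [← h _ (pre_pfx a (n + 1)) n hn, ← pre_T (pre_pfx a (n + 1)) n hn]

theorem T_zero (j k : ℕ) (a : W2) : T j k a 0 = true := by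
  have := pre_T (j := j) (k := k) (pre_pfx a 1)
  rw [show pfx a 1 = [a 0] by simp [pfx], ap_cons, pre_cons] at this
  exact this.1.symm

theorem pre_T_branch {j k : ℕ} (hjk : j < k) {a : W2} {P : List Bool} {c : Bool}
    (h : Pre a (P ++ [c])) :
    Pre (T j k a) (ap j k P ++ (true :: List.replicate j false) ++ [!c]) := by
  have h1 : Pre a (P ++ [c] ++ [a (P ++ [c]).length]) := pre_concat.mpr ⟨h, rfl⟩
  refine (pre_T h1).mono ?_
  rw [ap_append, ap_append, ap_cons, ap_cons, List.append_assoc, List.append_assoc,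
    List.prefix_append_right_inj]
  cases c
  · simp [ap_nil]
  · obtain ⟨d, rfl⟩ := Nat.exists_eq_add_of_lt hjk
    have : List.replicate (j + d + 1) false
        = List.replicate j false ++ false :: List.replicate d false := by
      rw [add_assoc, List.replicate_add, List.replicate_succ]
    simp only [if_true, this]
    simp

theorem T_injective {j k : ℕ} (hjk : j < k) : Function.Injective (T j k) := by
  intro a b hab
  by_contra hne
  obtain ⟨P, c, ha, hb⟩ := exists_branch hne
  exact ne_of_branch (pre_T_branch hjk ha) (pre_T_branch hjk hb) hab

theorem shiftn_T {j k : ℕ} {a : W2} {P : List Bool} (h : Pre a P) :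
    shiftn (T j k a) (ap j k P).length = T j k (shiftn a P.length) := by
  apply eq_T_of_pre
  intro Q hQ
  have := pre_T (j := j) (k := k) (pre_append.mpr ⟨h, hQ⟩)
  rw [ap_append, pre_append] at this
  exact this.2

theorem ap_split {j k : ℕ} : ∀ {P y z : List Bool}, ap j k P = y ++ true :: z →
    ∃ P₁ c P₂, P = P₁ ++ c :: P₂ ∧ y = ap j k P₁ ∧ true :: z = ap j k (c :: P₂)
  | [], y, z, h => by simp [ap_nil] at h
  | c :: P, [], z, h => ⟨[], c, P, rfl, rfl, by simpa using h.symm⟩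
  | c :: P, b :: y, z, h => by
    rw [ap_cons, List.cons_append, List.cons.injEq, List.append_eq_append_iff] at h
    obtain ⟨rfl, ⟨a, rfl, h⟩ | ⟨a, h1, h2⟩⟩ := h
    · obtain ⟨P₁, d, P₂, rfl, rfl, h3⟩ := ap_split h
      exact ⟨c :: P₁, d, P₂, rfl, by rw [ap_cons], h3⟩
    · cases a with
      | nil =>
        obtain ⟨P₁, d, P₂, rfl, h4, h3⟩ := ap_split (P := P) (y := []) h2.symm
        refine ⟨c :: P₁, d, P₂, rfl, ?_, h3⟩
        rw [ap_cons, ← h4, h1]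
        simp
      | cons d a =>
        have : d ∈ List.replicate (if c then k else j) false := by rw [h1]; simp
        rw [List.mem_replicate] at this
        simp [this.2] at h2

theorem run_compare {j k : ℕ} {P : List Bool} {b : Bool} {z : List Bool} : ∀ {l e : ℕ},
    List.replicate l false ++ b :: z = List.replicate e false ++ ap j k P →
      (b = true → l = e) ∧ (b = false → l < e)
  | 0, 0, h => by
    cases P with
    | nil => simp [ap_nil] at h
    | cons c P => rw [ap_cons] at h; simp at h; simp [h.1]
  | 0, e + 1, h => by
    simp [List.replicate_succ] at h
    simp [h.1]
  | l + 1, 0, h => by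
    cases P with
    | nil => simp [ap_nil] at h
    | cons c P => rw [ap_cons] at h; simp [List.replicate_succ] at h
  | l + 1, e + 1, h => by
    simp only [List.replicate_succ, List.cons_append, List.cons.injEq, true_and] at h
    have := run_compare h
    exact ⟨fun hb => by rw [this.1 hb], fun hb => Nat.succ_lt_succ (this.2 hb)⟩

theorem T_occurrence {j k : ℕ} {a : W2} {y : List Bool} {l : ℕ} {b : Bool}
    (h : Pre (T j k a) (y ++ true :: (List.replicate l false ++ [b]))) :
    ∃ (P : List Bool) (c : Bool), Pre a (P ++ [c]) ∧ y = ap j k P ∧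
      (b = true → l = if c then k else j) ∧ (b = false → l < if c then k else j) := by
  set n := (y ++ true :: (List.replicate l false ++ [b])).length with hn
  have h1 := pre_pfx a n
  obtain ⟨z, hz⟩ := h.prefix_of_length_le (pre_T h1) (by
    have := length_le_length_ap j k (pfx a n)
    rwa [length_pfx] at this)
  have hz' : ap j k (pfx a n) = y ++ true :: (List.replicate l false ++ b :: z) := by
    rw [← hz]; simp
  obtain ⟨P₁, c, P₂, hP, hy, hc⟩ := ap_split hz'
  refine ⟨P₁, c, h1.mono ⟨P₂, by simp [hP]⟩, hy, ?_⟩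
  rw [ap_cons] at hc
  exact run_compare (List.cons.inj hc).2

theorem exists_shiftn_T {j k : ℕ} {a : W2} {n : ℕ} (h : T j k a n = true) :
    ∃ i, shiftn (T j k a) n = T j k (shiftn a i) := by
  set y := pfx (T j k a) n
  have hy : Pre (T j k a) (y ++ true :: (List.replicate 0 false ++ [T j k a (n + 1)])) := by
    have : y ++ true :: (List.replicate 0 false ++ [T j k a (n + 1)])
      = y ++ [true] ++ [T j k a (n + 1)] := by simp
    rw [this, pre_concat, pre_concat]
    simp [y, length_pfx, pre_pfx, h]
  obtain ⟨P, c, hP, h1, -⟩ := T_occurrence hy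
  refine ⟨P.length, ?_⟩
  rw [← shiftn_T (hP.mono (List.prefix_append _ _)), ← h1, length_pfx]

/-! ### Right special factors -/

/-- `w` is a right special factor of `m`. -/
def RightSpecial (m : W2) (w : List Bool) : Prop := ∀ b, ∃ u, Pre m (u ++ w ++ [b])

/-- The longest right special word forced by a right special word `v` of the preimage under
`τ_{j,k}`. -/
def Phi (j k : ℕ) (v : List Bool) : List Bool :=
  List.replicate j false ++ ap j k v ++ true :: List.replicate j false

theorem eq_replicate_or_split (s : List Bool) :
    (∃ i, s = List.replicate i false) ∨ ∃ x l, s = x ++ true :: List.replicate l false := by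
  induction s using List.reverseRecOn with
  | nil => exact Or.inl ⟨0, rfl⟩
  | append_singleton s c ih =>
    cases c
    · rcases ih with ⟨i, rfl⟩ | ⟨x, l, rfl⟩
      · exact Or.inl ⟨i + 1, by rw [List.replicate_succ']⟩
      · exact Or.inr ⟨x, l + 1, by rw [List.replicate_succ']; simp⟩
    · exact Or.inr ⟨s, 0, rfl⟩

theorem suffix_replicate_of_two_runs {j k : ℕ} (hjk : j < k) {x A B : List Bool}
    (h1 : x <:+ A ++ true :: List.replicate j false)
    (h2 : x <:+ B ++ true :: List.replicate k false) : x <:+ List.replicate j false := by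
  have h3 : List.replicate j false <:+ A ++ true :: List.replicate j false :=
    ⟨A ++ [true], by simp⟩
  rcases List.suffix_or_suffix_of_suffix h1 h3 with h | ⟨y, rfl⟩
  · exact h
  · obtain ⟨s, hs⟩ := h1
    obtain ⟨t, ht⟩ := h2
    obtain ⟨d, rfl⟩ := Nat.exists_eq_add_of_lt hjk
    have e1 : s ++ y = A ++ [true] := by
      apply List.append_cancel_right (bs := List.replicate j false)
      simpa using hs
    have e2 : t ++ y = B ++ true :: List.replicate d false ++ [false] := by
      apply List.append_cancel_right (bs := List.replicate j false)
      have : List.replicate (j + d + 1) false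
          = List.replicate d false ++ (false :: List.replicate j false) := by
        rw [← List.replicate_succ, ← List.replicate_add]; congr 1; omega
      rw [this] at ht
      simpa using ht
    rcases List.eq_nil_or_concat' y with rfl | ⟨y', c, rfl⟩
    · simp
    · rw [← List.append_assoc] at e1 e2
      have f1 := (List.append_inj' e1 rfl).2
      have f2 := (List.append_inj' e2 rfl).2
      simp_all

theorem exists_common_suffix {j k : ℕ} (hjk : j < k) : ∀ {P P' x : List Bool},
    x <:+ ap j k P → x <:+ ap j k P' →
      ∃ v, v <:+ P ∧ v <:+ P' ∧ v.length ≤ x.length ∧ x <:+ List.replicate j false ++ ap j k v := by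
  intro P
  induction P using List.reverseRecOn with
  | nil =>
    intro P' x h1 h2
    rw [ap_nil, List.suffix_nil] at h1
    subst h1
    exact ⟨[], by simp⟩
  | append_singleton P c ih =>
    intro P' x h1 h2
    rcases List.eq_nil_or_concat' P' with rfl | ⟨Q, d, rfl⟩
    · rw [ap_nil, List.suffix_nil] at h2
      subst h2
      exact ⟨[], by simp⟩
    · by_cases hx : x = []
      · subst hx
        exact ⟨[], by simp⟩
      by_cases hcd : c = d
      · subst hcd
        rw [ap_append] at h1 h2
        rcases List.suffix_or_suffix_of_suffix h1 (List.suffix_append _ _) with h | ⟨y, rfl⟩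
        · refine ⟨[c], List.suffix_append _ _, List.suffix_append _ _, ?_,
            h.trans (List.suffix_append _ _)⟩
          exact List.length_pos_iff.mpr hx
        · obtain ⟨s, hs⟩ := h1
          obtain ⟨t, ht⟩ := h2
          rw [← List.append_assoc] at hs ht
          obtain ⟨v, ⟨p, rfl⟩, ⟨q, rfl⟩, hv3, ⟨r, hr⟩⟩ := ih ⟨s, List.append_cancel_right hs⟩
            ⟨t, List.append_cancel_right ht⟩
          refine ⟨v ++ [c], ⟨p, by simp⟩, ⟨q, by simp⟩, ?_, ⟨r, ?_⟩⟩
          · rw [ap_cons]; simp; omega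
          · rw [ap_append, ← List.append_assoc, hr]; simp
      · refine ⟨[], by simp, by simp, by simp, ?_⟩
        rw [ap_append, ap_cons] at h1 h2
        rw [ap_nil, List.append_nil] at *
        cases c <;> cases d <;> simp at hcd
        · exact suffix_replicate_of_two_runs hjk (by simpa using h1) (by simpa using h2)
        · exact suffix_replicate_of_two_runs hjk (by simpa using h2) (by simpa using h1)

theorem RightSpecial.desubstitute {j k : ℕ} (hjk : j < k) {a : W2} {w : List Bool}
    (hw : RightSpecial (T j k a) w) : (∃ i < k, w = List.replicate i false) ∨
      ∃ v, RightSpecial a v ∧ v.length < w.length ∧ w <:+ Phi j k v := by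
  obtain ⟨u, hu⟩ := hw false
  obtain ⟨u', hu'⟩ := hw true
  rcases eq_replicate_or_split w with ⟨i, rfl⟩ | ⟨x, l, rfl⟩
  · left
    refine ⟨i, ?_, rfl⟩
    rcases eq_replicate_or_split u with ⟨i', rfl⟩ | ⟨x, l, rfl⟩
    · exfalso
      rw [← List.replicate_add, ← List.replicate_succ', List.replicate_succ, pre_cons, T_zero] at hu
      simp at hu
    · have : x ++ true :: List.replicate l false ++ List.replicate i false ++ [false]
          = x ++ true :: (List.replicate (l + i) false ++ [false]) := by
        rw [List.replicate_add]; simp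
      rw [this] at hu
      obtain ⟨P, c, -, -, -, h⟩ := T_occurrence hu
      have := h rfl
      split_ifs at this <;> omega
  · right
    have e1 : ∀ u b, u ++ (x ++ true :: List.replicate l false) ++ [b]
        = (u ++ x) ++ true :: (List.replicate l false ++ [b]) := by simp
    rw [e1] at hu hu'
    obtain ⟨P, c, hP, hx, -, h⟩ := T_occurrence hu
    obtain ⟨P', c', hP', hx', h', -⟩ := T_occurrence hu'
    have h := h rfl
    have h' := h' rfl
    have hc : c = true ∧ c' = false ∧ l = j := by
      cases c <;> cases c' <;> simp at h h' ⊢ <;> omega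
    obtain ⟨rfl, rfl, rfl⟩ := hc
    obtain ⟨v, ⟨p, rfl⟩, ⟨q, rfl⟩, hv, hxv⟩ :=
      exists_common_suffix hjk ⟨u, hx⟩ ⟨u', hx'⟩
    refine ⟨v, ?_, ?_, ?_⟩
    · intro b
      cases b
      · exact ⟨q, hP'⟩
      · exact ⟨p, hP⟩
    · simp; omega
    · obtain ⟨r, hr⟩ := hxv
      exact ⟨r, by simp only [Phi]; rw [← hr]; simp⟩

/-- The ends of the finite branches of the tree of right special words of an `S`-adic word. -/
def branchEnd : ℕ → (ℕ → ℕ × ℕ) → List Bool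
  | 0, s => List.replicate ((s 0).2 - 1) false
  | r + 1, s => Phi (s 0).1 (s 0).2 (branchEnd r fun n => s (n + 1))

/-- The points where the finite branches of the tree of right special words of an `S`-adic word
leave the infinite branch. -/
def branchPoint : ℕ → (ℕ → ℕ × ℕ) → List Bool
  | 0, s => List.replicate (s 0).1 false
  | r + 1, s => Phi (s 0).1 (s 0).2 (branchPoint r fun n => s (n + 1))

theorem replicate_suffix_replicate {i k : ℕ} (h : i ≤ k) :
    List.replicate i false <:+ List.replicate k false := by
  obtain ⟨d, rfl⟩ := Nat.exists_eq_add_of_le h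
  rw [add_comm, List.replicate_add]
  exact List.suffix_append _ _

theorem Phi_suffix {j k : ℕ} (hjk : j < k) {v w : List Bool} (h : v <:+ w) :
    Phi j k v <:+ Phi j k w := by
  obtain ⟨u, rfl⟩ := h
  rcases List.eq_nil_or_concat' u with rfl | ⟨u, c, rfl⟩
  · exact List.suffix_refl _
  · have : List.replicate j false <:+ List.replicate (if c then k else j) false :=
      replicate_suffix_replicate (by split_ifs <;> omega)
    obtain ⟨r, hr⟩ := this
    refine ⟨List.replicate j false ++ ap j k u ++ true :: r, ?_⟩
    simp only [Phi, ap_append, ap_cons, ap_nil, hr.symm]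
    simp

theorem branchPoint_suffix_branchEnd : ∀ {r t : ℕ} {s : ℕ → ℕ × ℕ}, (∀ n, (s n).1 < (s n).2) →
    r ≤ t → branchPoint r s <:+ branchEnd t s
  | 0, 0, s, hs, _ => by
    have := hs 0
    exact replicate_suffix_replicate (by omega)
  | 0, t + 1, s, hs, _ => by
    simp only [branchPoint, branchEnd, Phi]
    exact (List.suffix_cons _ _).trans (List.suffix_append _ _)
  | r + 1, t + 1, s, hs, h =>
    Phi_suffix (hs 0) (branchPoint_suffix_branchEnd (fun n => hs (n + 1)) (by omega))

theorem count_false_ap (j k : ℕ) (v : List Bool) :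
    (ap j k v).count false = j * v.count false + k * v.count true := by
  induction v with
  | nil => simp [ap_nil]
  | cons c v ih => rw [ap_cons]; cases c <;> simp [ih] <;> ring

theorem count_true_ap (j k : ℕ) (v : List Bool) :
    (ap j k v).count true = v.count false + v.count true := by
  induction v with
  | nil => simp [ap_nil]
  | cons c v ih =>
    rw [ap_cons]
    cases c <;>
      simp [ih, List.count_replicate, -List.count_false_add_count_true] <;> ring

theorem count_Phi_mono (j k : ℕ) {v w : List Bool} (h : ∀ b, v.count b ≤ w.count b) (b : Bool) :
    (Phi j k v).count b ≤ (Phi j k w).count b := by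
  have h0 := h false
  have h1 := h true
  cases b
  · simp only [Phi, List.count_append, count_false_ap]
    gcongr
  · simp only [Phi, List.count_append, count_true_ap]
    gcongr

theorem count_branchEnd_le : ∀ (r : ℕ) (s : ℕ → ℕ × ℕ) (b : Bool),
    (branchEnd r s).count b ≤ (branchPoint (r + 2) s).count b
  | 0, s, b => by
    cases b
    · simp only [branchEnd, branchPoint, Phi, List.count_append, count_false_ap]
      simp [List.count_replicate, mul_add]
      omega
    · simp [branchEnd, List.count_replicate]
  | r + 1, s, b => count_Phi_mono _ _ (count_branchEnd_le r _) b

theorem length_branchEnd_le (r : ℕ) (s : ℕ → ℕ × ℕ) :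
    (branchEnd r s).length ≤ (branchPoint (r + 2) s).length := by
  rw [← List.count_true_add_count_false, ← List.count_true_add_count_false (branchPoint _ _)]
  exact add_le_add (count_branchEnd_le _ _ _) (count_branchEnd_le _ _ _)

theorem rightSpecial_w10inf {w : List Bool} (h : RightSpecial w10inf w) : w = [] := by
  obtain ⟨u, hu⟩ := h true
  have := (pre_concat.mp hu).2
  simp [w10inf] at this
  exact this.2

/-- If `G` is a class of words each of which is `10^∞` or the image of a word of `G` under some
`τ_{j,k}` with `j < k`, then right special factors of words in `G` are suffixes of branch ends. -/
theorem rightSpecial_suffix_branchEnd {G : W2 → Prop}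
    (hG : ∀ m, G m → m = w10inf ∨ ∃ j k m', j < k ∧ G m' ∧ m = T j k m') :
    ∀ (N : ℕ) (m : W2), G m → ∃ s : ℕ → ℕ × ℕ, (∀ n, (s n).1 < (s n).2) ∧
      ∀ w, RightSpecial m w → w.length ≤ N → ∃ r, w <:+ branchEnd r s := by
  intro N
  induction N with
  | zero =>
    intro m _
    refine ⟨fun _ => (0, 1), by simp, fun w _ hw => ⟨0, ?_⟩⟩
    rw [List.length_eq_zero_iff.mp (Nat.le_zero.mp hw)]
    exact List.nil_suffix
  | succ N ih =>
    intro m hm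
    rcases hG m hm with rfl | ⟨j, k, m', hjk, hm', rfl⟩
    · refine ⟨fun _ => (0, 1), by simp, fun w h _ => ⟨0, ?_⟩⟩
      rw [rightSpecial_w10inf h]
      exact List.nil_suffix
    · obtain ⟨s, hs, h⟩ := ih m' hm'
      refine ⟨fun n => Nat.casesOn n (j, k) s, ?_, fun w hw hN => ?_⟩
      · rintro (_ | n)
        · exact hjk
        · exact hs n
      · rcases hw.desubstitute hjk with ⟨i, hi, rfl⟩ | ⟨v, hv, hl, hvw⟩
        · exact ⟨0, replicate_suffix_replicate (Nat.le_sub_one_of_lt hi)⟩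
        · obtain ⟨r, hr⟩ := h v hv (by omega)
          exact ⟨r + 1, hvw.trans (Phi_suffix hjk hr)⟩

theorem exists_three_words_of_suffix {s : ℕ → ℕ × ℕ} (hs : ∀ n, (s n).1 < (s n).2) (n : ℕ) :
    ∃ A B C : List Bool, ∀ w, w.length = n → (∃ r, w <:+ branchEnd r s) →
      w = A ∨ w = B ∨ w = C := by
  by_cases hr : ∃ r, n ≤ (branchEnd r s).length
  · have hmin := fun t => Nat.find_min hr (m := t)
    have hspec := Nat.find_spec hr
    set r := Nat.find hr
    refine ⟨(branchEnd r s).rtake n, (branchEnd (r + 1) s).rtake n,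
      (branchPoint (r + 2) s).rtake n, ?_⟩
    rintro w hw ⟨t, ht⟩
    have hlt : r ≤ t := by
      by_contra hlt
      exact hmin t (by omega) (by rw [← hw]; exact ht.length_le)
    have key : ∀ l : List Bool, w <:+ l → w = l.rtake n := by
      intro l hl
      rw [List.rtake, ← hw]
      exact List.suffix_iff_eq_drop.mp hl
    rcases Nat.lt_or_ge t (r + 2) with h2 | h2
    · obtain rfl | rfl : t = r ∨ t = r + 1 := by omega
      · exact Or.inl (key _ ht)
      · exact Or.inr (Or.inl (key _ ht))
    · refine Or.inr (Or.inr (key _ ?_))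
      refine List.suffix_of_suffix_length_le ht (branchPoint_suffix_branchEnd hs h2) ?_
      have := length_branchEnd_le r s
      omega
  · refine ⟨[], [], [], fun w hw ⟨r, h⟩ => (hr ⟨r, hw ▸ h.length_le⟩).elim⟩

theorem mem_factorSet_iff {m : W2} {n : ℕ} {w : List Bool} :
    w ∈ factorSet m n ↔ w.length = n ∧ ∃ u, Pre m (u ++ w) := by
  constructor
  · rintro ⟨k, rfl⟩
    refine ⟨by simp, pfx m k, pre_append.mpr ⟨pre_pfx _ _, ?_⟩⟩
    intro i hi
    simp [length_pfx, shiftn, add_comm]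
  · rintro ⟨rfl, u, hu⟩
    refine ⟨u.length, ?_⟩
    apply List.ext_getElem
    · simp
    · intro i h1 h2
      rw [(pre_append.mp hu).2 i h1]
      simp [shiftn, add_comm]

theorem finite_factorSet (m : W2) (n : ℕ) : (factorSet m n).Finite :=
  (List.finite_length_eq Bool n).subset fun _ h => (mem_factorSet_iff.mp h).1

theorem complexity_succ_le (m : W2) (n : ℕ) {A B C : List Bool}
    (h : ∀ w, w.length = n → RightSpecial m w → w = A ∨ w = B ∨ w = C) :
    complexity m (n + 1) ≤ complexity m n + 3 := by
  set R : Set (List Bool) := {w | w.length = n ∧ RightSpecial m w}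
  have hR : R ⊆ {A, B, C} := fun w hw => by simpa using h w hw.1 hw.2
  have hR3 : R.ncard ≤ 3 := (Set.ncard_le_ncard hR (by simp)).trans (by
    have := Finset.card_le_three (a := A) (b := B) (c := C)
    rw [← Set.ncard_coe_finset] at this
    simpa using this)
  have hRf : R.Finite := (by simp : ({A, B, C} : Set (List Bool)).Finite).subset hR
  set f : List Bool → List Bool := fun w =>
    w ++ [if ∃ u, Pre m (u ++ w ++ [true]) then true else false]
  have hsub : factorSet m (n + 1) ⊆
      f '' factorSet m n ∪ (fun w => w ++ [false]) '' R := by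
    intro x hx
    obtain ⟨hl, u, hu⟩ := mem_factorSet_iff.mp hx
    rcases List.eq_nil_or_concat' x with rfl | ⟨w, c, rfl⟩
    · simp at hl
    · have hw : w.length = n := by simpa using hl
      rw [← List.append_assoc] at hu
      have hwf : w ∈ factorSet m n :=
        mem_factorSet_iff.mpr ⟨hw, u, hu.mono (List.prefix_append _ _)⟩
      by_cases h1 : ∃ u, Pre m (u ++ w ++ [true])
      · cases c
        · right
          refine ⟨w, ⟨hw, fun b => ?_⟩, rfl⟩
          cases b
          · exact ⟨u, hu⟩
          · exact h1
        · left
          exact ⟨w, hwf, by simp only [f, if_pos h1]⟩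
      · left
        cases c
        · exact ⟨w, hwf, by simp only [f, if_neg h1]⟩
        · exact (h1 ⟨u, hu⟩).elim
  have hf := finite_factorSet m n
  calc complexity m (n + 1) ≤ (f '' factorSet m n ∪ (fun w => w ++ [false]) '' R).ncard :=
        Set.ncard_le_ncard hsub ((hf.image _).union (hRf.image _))
    _ ≤ _ := Set.ncard_union_le _ _
    _ ≤ complexity m n + 3 :=
        add_le_add (Set.ncard_image_le hf) ((Set.ncard_image_le hRf).trans hR3)

theorem complexity_two_le (m : W2) : complexity m 2 ≤ 4 := by
  have hsub : factorSet m 2 ⊆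
      (({[true, true], [true, false], [false, true], [false, false]} : Finset (List Bool)) :
        Set (List Bool)) := by
    intro x hx
    have hl := (mem_factorSet_iff.mp hx).1
    obtain ⟨a, b, rfl⟩ := List.length_eq_two.mp hl
    cases a <;> cases b <;> simp
  refine (Set.ncard_le_ncard hsub (Finset.finite_toSet _)).trans ?_
  rw [Set.ncard_coe_finset]
  exact Finset.card_le_four

theorem complexity_le {G : W2 → Prop}
    (hG : ∀ m, G m → m = w10inf ∨ ∃ j k m', j < k ∧ G m' ∧ m = T j k m') {m : W2} (hm : G m)
    (n : ℕ) (hn : 2 ≤ n) : complexity m n ≤ 3 * n - 2 := by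
  induction n, hn using Nat.le_induction with
  | base => exact complexity_two_le m
  | succ n hn ih =>
    obtain ⟨s, hs, h⟩ := rightSpecial_suffix_branchEnd hG n m hm
    obtain ⟨A, B, C, hABC⟩ := exists_three_words_of_suffix hs n
    have := complexity_succ_le m n (fun w hw hr => hABC w hw (h w hr hw.le))
    omega

/-! ### Cylinder orders -/

/-- A total order on infinite words for which cylinders are convex. -/
structure ConvexOrder (le : W2 → W2 → Prop) : Prop where
  total : ∀ a b, le a b ∨ le b a
  antisymm : ∀ a b, le a b → le b a → a = b
  trans : ∀ a b c, le a b → le b c → le a c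
  convex : ∀ {a b c P}, le a b → le b c → Pre a P → Pre c P → Pre b P

theorem wdist_lt_iff {A : Type*} [DecidableEq A] {a b : ℕ → A} {n : ℕ} :
    wdist a b < (2 : ℝ)⁻¹ ^ n ↔ ∀ i < n, a i = b i := by
  unfold wdist
  split_ifs with h
  · rw [pow_lt_pow_iff_right_of_lt_one₀ (by norm_num) (by norm_num), Nat.lt_succ_iff,
      Nat.le_find_iff]
    simp
  · push Not at h
    simp [h]

theorem convexOrder_of_isCylOrder {le : W2 → W2 → Prop} (h : IsCylOrder le) : ConvexOrder le where
  total := h.1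
  antisymm := h.2.1
  trans := h.2.2.1
  convex {a b c P} hab hbc ha hc := by
    refine pre_of_agree ?_ ha
    rw [← wdist_lt_iff]
    exact (h.2.2.2 a b c hab hbc).trans_lt (wdist_lt_iff.mpr (agree_of_pre ha hc))

/-- `x` is an accumulation point of the set of words satisfying `M`. -/
def AccPoint (M : W2 → Prop) (x : W2) : Prop :=
  ∀ P, Pre x P → ∃ y, M y ∧ y ≠ x ∧ Pre y P

theorem isAccPt'_iff {M : Set W2} {x : W2} : IsAccPt' M x ↔ AccPoint (· ∈ M) x := by
  constructor
  · intro h P hP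
    obtain ⟨y, hy, hne, hd⟩ := h ((2 : ℝ)⁻¹ ^ P.length) (by positivity)
    exact ⟨y, hy, hne, pre_of_agree (wdist_lt_iff.mp hd) hP⟩
  · intro h ε hε
    obtain ⟨n, hn⟩ := exists_pow_lt_of_lt_one hε (show (2 : ℝ)⁻¹ < 1 by norm_num)
    obtain ⟨y, hy, hne, hP⟩ := h (pfx x n) (pre_pfx x n)
    refine ⟨y, hy, hne, (wdist_lt_iff.mpr ?_).trans hn⟩
    have := agree_of_pre (pre_pfx x n) hP
    rwa [length_pfx] at this

/-- `y` dominates all its tails. -/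
def Dominant (le : W2 → W2 → Prop) (y : W2) : Prop := ∀ n, le (shiftn y n) y

namespace ConvexOrder

variable {le : W2 → W2 → Prop}

theorem refl (h : ConvexOrder le) (a : W2) : le a a := (h.total a a).elim id id

theorem of_not (h : ConvexOrder le) {a b : W2} (hab : ¬ le a b) : le b a :=
  (h.total a b).resolve_left hab

theorem le_of_branch (h : ConvexOrder le) {a b a' b' : W2} {P : List Bool} {c : Bool}
    (hab : le a b) (ha : Pre a (P ++ [c])) (hb : Pre b (P ++ [!c]))
    (ha' : Pre a' (P ++ [c])) (hb' : Pre b' (P ++ [!c])) : le a' b' := by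
  have h1 : le a' b := by
    by_contra hn
    exact not_pre_branch (h.convex hab (h.of_not hn) ha ha') hb
  by_contra hn
  exact not_pre_branch ha' (h.convex (h.of_not hn) h1 hb' hb)

theorem isClosed_le (h : ConvexOrder le) (b : W2) : IsClosed {a | le a b} := by
  rw [← isOpen_compl_iff, isOpen_pi_iff]
  intro a ha
  have hne : b ≠ a := by rintro rfl; exact ha (h.refl _)
  obtain ⟨P, c, hb, hac⟩ := exists_branch hne
  refine ⟨Finset.range (P ++ [!c]).length, fun i => {a i}, fun i _ => ⟨isOpen_discrete _, rfl⟩, ?_⟩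
  intro a' ha' hle
  have ha'2 : Pre a' (P ++ [!c]) := by
    refine pre_of_agree (fun i hi => ?_) hac
    exact (ha' i (by simpa using hi)).symm
  have := h.le_of_branch (h.of_not ha) hb hac hb ha'2
  exact ne_of_branch hb ha'2 (h.antisymm _ _ this hle)

theorem isClosed_ge (h : ConvexOrder le) (b : W2) : IsClosed {a | le b a} := by
  rw [← isOpen_compl_iff, isOpen_pi_iff]
  intro a ha
  have hne : a ≠ b := by rintro rfl; exact ha (h.refl _)
  obtain ⟨P, c, hac, hb⟩ := exists_branch hne
  refine ⟨Finset.range (P ++ [c]).length, fun i => {a i}, fun i _ => ⟨isOpen_discrete _, rfl⟩, ?_⟩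
  intro a' ha' hle
  have ha'2 : Pre a' (P ++ [c]) := by
    refine pre_of_agree (fun i hi => ?_) hac
    exact (ha' i (by simpa using hi)).symm
  have := h.le_of_branch (h.of_not ha) hac hb ha'2 hb
  exact ne_of_branch ha'2 hb (h.antisymm _ _ this hle)

theorem exists_max (h : ConvexOrder le) {K : Set W2} (hK : IsCompact K) (hne : K.Nonempty) :
    ∃ μ ∈ K, ∀ x ∈ K, le x μ := by
  have : Nonempty K := hne.to_subtype
  have key := IsCompact.nonempty_iInter_of_directed_nonempty_isCompact_isClosed
    (fun b : K => K ∩ {a | le b a}) ?_ (fun b => ⟨b, b.2, h.refl _⟩)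
    (fun b => hK.inter_right (h.isClosed_ge _))
    (fun b => hK.isClosed.inter (h.isClosed_ge _))
  · obtain ⟨μ, hμ⟩ := key
    rw [Set.mem_iInter] at hμ
    exact ⟨μ, (hμ (Classical.arbitrary K)).1, fun x hx => (hμ ⟨x, hx⟩).2⟩
  · intro b c
    rcases h.total b c with hbc | hcb
    · exact ⟨c, fun x hx => ⟨hx.1, h.trans _ _ _ hbc hx.2⟩, fun x hx => hx⟩
    · exact ⟨b, fun x hx => hx, fun x hx => ⟨hx.1, h.trans _ _ _ hcb hx.2⟩⟩

theorem mem_supWords_iff (h : ConvexOrder le) {y : W2} : y ∈ supWords le ↔ Dominant le y := by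
  constructor
  · rintro ⟨a, hub, hmin⟩ n
    set K := closure (tails a)
    obtain ⟨μ, hμ, hmax⟩ := h.exists_max (K := K) isClosed_closure.isCompact
      ⟨a, subset_closure ⟨0, rfl⟩⟩
    have hle : ∀ x ∈ K, le x y := fun x hx =>
      closure_minimal (t := {x | le x y}) hub (h.isClosed_le y) hx
    have hyμ : y = μ :=
      h.antisymm _ _ (hmin μ fun x hx => hmax x (subset_closure hx)) (hle μ hμ)
    apply hle
    rw [← hyμ] at hμ
    refine map_mem_closure (f := fun x : W2 => shiftn x n) ?_ hμ ?_
    · exact continuous_pi fun i => continuous_apply (i + n)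
    · rintro x ⟨i, rfl⟩
      exact ⟨n + i, shiftn_shiftn _ _ _⟩
  · intro hy
    refine ⟨y, ?_, fun b hb => hb y ⟨0, rfl⟩⟩
    rintro x ⟨n, rfl⟩
    exact hy n

theorem dominant_of_accPoint (h : ConvexOrder le) {x : W2} (hx : AccPoint (Dominant le) x) :
    Dominant le x := by
  intro n
  by_contra hn
  have hne : x ≠ shiftn x n := by
    intro he
    exact hn (he ▸ h.refl _)
  obtain ⟨P, c, h1, h2⟩ := exists_branch hne
  obtain ⟨y, hy, -, hyP⟩ := hx (pfx x (n + P.length + 1)) (pre_pfx _ _)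
  have hag := agree_of_pre (pre_pfx _ _) hyP
  rw [length_pfx] at hag
  have h3 : Pre y (P ++ [c]) :=
    pre_of_agree (fun i hi => hag i (by simp at hi; omega)) h1
  have h4 : Pre (shiftn y n) (P ++ [!c]) :=
    pre_of_agree (fun i hi => hag (i + n) (by simp at hi; omega)) h2
  have := h.le_of_branch (h.of_not hn) h1 h2 h3 h4
  exact ne_of_branch h3 h4 (h.antisymm _ _ this (hy n))

end ConvexOrder

/-- Words starting with `0` are below words starting with `1`. -/
def Normalized (le : W2 → W2 → Prop) : Prop := ∀ a b : W2, a 0 = false → b 0 = true → le a b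

/-- `m` is the smallest accumulation point of the words dominating their tails. -/
def IsSmallestAccWord (le : W2 → W2 → Prop) (m : W2) : Prop :=
  AccPoint (Dominant le) m ∧ ∀ y, AccPoint (Dominant le) y → le m y

/-- The word `10^i1`. -/
abbrev blk (i : ℕ) : List Bool := true :: List.replicate i false ++ [true]

/-- In the given order, `[10^i1]` is below `10^∞`. -/
def Up (le : W2 → W2 → Prop) (i : ℕ) : Prop := ∃ b, Pre b (blk i) ∧ le b w10inf

theorem pre_w10inf (i : ℕ) : Pre w10inf (true :: List.replicate i false) := by
  rintro (_ | n) h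
  · simp [w10inf]
  · simp [w10inf]

theorem pre_w10inf_branch (i : ℕ) : Pre w10inf (true :: List.replicate i false ++ [!true]) := by
  have := pre_w10inf (i + 1)
  rwa [List.replicate_succ', ← List.cons_append] at this

theorem not_pre_blk_w10inf (i : ℕ) : ¬ Pre w10inf (blk i) := fun h =>
  not_pre_branch h (pre_w10inf_branch i)

theorem branch_prefix_blk {i i' : ℕ} (h : i < i') :
    true :: List.replicate i false ++ [!true] <+: blk i' := by
  obtain ⟨d, rfl⟩ := Nat.exists_eq_add_of_lt h
  refine ⟨List.replicate d false ++ [true], ?_⟩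
  have : i + d + 1 = i + (1 + d) := by omega
  simp [this, List.replicate_add]

theorem eq_w10inf_or_pre_blk {t : W2} (h : t 0 = true) : t = w10inf ∨ ∃ i, Pre t (blk i) := by
  by_cases hz : w10inf = t
  · exact Or.inl hz.symm
  · right
    obtain ⟨P, c, h1, h2⟩ := exists_branch hz
    cases P with
    | nil =>
      have h1 := (pre_cons.mp h1).1
      have h2 := (pre_cons.mp h2).1
      rw [h1, h] at h2
      simp [w10inf] at h2
    | cons p P =>
      have h3 : p :: P = true :: List.replicate P.length false := by
        refine ((h1.mono (List.prefix_append _ _)).prefix_of_length_le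
          (pre_w10inf P.length) (by simp)).eq_of_length (by simp)
      have hc : c = false := by
        rw [← (pre_concat.mp h1).2]
        simp [w10inf]
      subst hc
      rw [h3] at h2
      exact ⟨_, h2⟩

namespace ConvexOrder

variable {le : W2 → W2 → Prop}

theorem le_w10inf_of_up (h : ConvexOrder le) {i : ℕ} (hi : Up le i) {b t : W2}
    (hb : Pre b (blk i)) (ht : Pre t (true :: List.replicate i false ++ [!true])) : le b t := by
  obtain ⟨b', hb', hle⟩ := hi
  exact h.le_of_branch hle hb' (pre_w10inf_branch i) hb ht

theorem up_of_le (h : ConvexOrder le) {i : ℕ} {b t : W2}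
    (hb : Pre b (blk i)) (ht : Pre t (true :: List.replicate i false ++ [!true]))
    (hle : le b t) : Up le i :=
  ⟨b, hb, h.le_of_branch hle hb ht hb (pre_w10inf_branch i)⟩

theorem exists_up_of_le (h : ConvexOrder le) {c : ℕ} (hc : Up le c) {y t : W2}
    (hy : Pre y (blk c)) (ht : t 0 = true) (hty : le t y) : ∃ i ≤ c, Up le i ∧ Pre t (blk i) := by
  have hgt : ¬ Pre t (true :: List.replicate c false ++ [!true]) := fun h1 =>
    ne_of_branch hy h1 (h.antisymm _ _ (h.le_w10inf_of_up hc hy h1) hty)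
  rcases eq_w10inf_or_pre_blk ht with rfl | ⟨i, hi⟩
  · exact (hgt (pre_w10inf_branch c)).elim
  · rcases lt_trichotomy i c with hic | rfl | hic
    · exact ⟨i, hic.le, h.up_of_le hi (hy.mono (branch_prefix_blk hic)) hty, hi⟩
    · exact ⟨i, le_rfl, hc, hi⟩
    · exact (hgt (hi.mono (branch_prefix_blk hic))).elim

end ConvexOrder

theorem ap_singleton_concat (j k : ℕ) (c : Bool) :
    ap j k [c] ++ [true] = blk (if c then k else j) := by
  rw [ap_cons, ap_nil]; simp

/-- A word starting with `1` whose blocks are all `10^j` or `10^k` can be desubstituted. -/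
theorem exists_eq_T {j k : ℕ} {y : W2} (h0 : y 0 = true)
    (h : ∀ n, y n = true → Pre (shiftn y n) (blk j) ∨ Pre (shiftn y n) (blk k)) :
    ∃ a, y = T j k a := by
  have hstep : ∀ n, y n = true → ∃ c : Bool, Pre (shiftn y n) (ap j k [c] ++ [true]) := by
    intro n hn
    rcases h n hn with h1 | h1
    · exact ⟨false, by rwa [ap_singleton_concat]⟩
    · exact ⟨true, by rwa [ap_singleton_concat]⟩
  choose f hf using hstep
  let g : ℕ → Bool := fun n => if hn : y n = true then f n hn else false
  let s : ℕ → ℕ := fun i => Nat.rec 0 (fun _ n => n + (ap j k [g n]).length) i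
  have hs : ∀ i, s (i + 1) = s i + (ap j k [g (s i)]).length := fun i => rfl
  refine ⟨fun i => g (s i), eq_T_of_pre ?_⟩
  suffices H : ∀ P, Pre (fun i => g (s i)) P →
      (ap j k P).length = s P.length ∧ Pre y (ap j k P ++ [true]) from
    fun P hP => (H P hP).2.mono (List.prefix_append _ _)
  intro P
  induction P using List.reverseRecOn with
  | nil =>
    intro _
    refine ⟨rfl, ?_⟩
    rw [ap_nil, pre_concat]
    exact ⟨pre_nil _, h0⟩
  | append_singleton P c ih =>
    intro hP
    obtain ⟨hP1, rfl⟩ := pre_concat.mp hP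
    obtain ⟨hl, hy⟩ := ih hP1
    have hy' := pre_concat.mp hy
    have h1 : y (s P.length) = true := hl ▸ hy'.2
    have hg : g (s P.length) = f _ h1 := dif_pos h1
    refine ⟨?_, ?_⟩
    · rw [ap_append, List.length_append, hl, List.length_append, List.length_singleton, hs]
    · rw [ap_append, List.append_assoc, pre_append, hl, hg]
      exact ⟨hy'.1, hf _ h1⟩

namespace ConvexOrder

variable {le : W2 → W2 → Prop}

theorem eq_zero_of_dominant (h : ConvexOrder le) (hN : Normalized le) {y : W2}
    (hy : Dominant le y) (h0 : y 0 = false) : y = fun _ => false := by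
  funext n
  by_contra hn
  have hn : shiftn y n 0 = true := by simpa [shiftn] using hn
  have := h.antisymm _ _ (hN y _ h0 hn) (hy n)
  rw [← this, h0] at hn
  exact absurd hn (by simp)

theorem accPoint_zero (h : ConvexOrder le) (hN : Normalized le) {m : W2}
    (hm : AccPoint (Dominant le) m) : m 0 = true := by
  by_contra h0
  rw [Bool.not_eq_true] at h0
  obtain ⟨y, hy, hne, hp⟩ := hm [false] (pre_cons.mpr ⟨h0.symm, pre_nil _⟩)
  have hy0 := (pre_cons.mp hp).1.symm
  rw [h.eq_zero_of_dominant hN hy hy0,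
    h.eq_zero_of_dominant hN (h.dominant_of_accPoint hm) h0] at hne
  exact hne rfl

theorem dominant_T (hN : Normalized le) {j k : ℕ} {a : W2}
    (ha : ∀ i, le (T j k (shiftn a i)) (T j k a)) : Dominant le (T j k a) := by
  intro n
  cases hn : T j k a n
  · exact hN _ _ (by simpa [shiftn] using hn) (T_zero _ _ _)
  · obtain ⟨i, hi⟩ := exists_shiftn_T hn
    rw [hi]
    exact ha i

theorem accPoint_w10inf (h : ConvexOrder le) (hN : Normalized le) :
    AccPoint (Dominant le) w10inf := by
  intro P hP
  set n := P.length
  have hT : Pre (T n n w0) (blk n) := by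
    have h1 : Pre w0 [false, false] := by
      rw [pre_cons, pre_cons]
      exact ⟨rfl, rfl, pre_nil _⟩
    refine (pre_T h1).mono ?_
    simp [ap_cons, ap_nil]
  refine ⟨T n n w0, dominant_T hN fun i => h.refl _, ?_, ?_⟩
  · intro he
    exact not_pre_blk_w10inf n (he ▸ hT)
  · refine hT.mono ?_
    have h1 : P <+: true :: List.replicate n false :=
      hP.prefix_of_length_le (pre_w10inf n) (by simp [n])
    exact h1.trans (List.prefix_append _ _)

/-- The order induced by `le` through the substitution `τ_{j,k}`. -/
theorem induced (h : ConvexOrder le) {j k : ℕ} (hjk : j < k) :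
    ConvexOrder fun a b => le (T j k a) (T j k b) where
  total _ _ := h.total _ _
  antisymm _ _ h1 h2 := T_injective hjk (h.antisymm _ _ h1 h2)
  trans _ _ _ h1 h2 := h.trans _ _ _ h1 h2
  convex {a b c P} hab hbc ha hc := by
    by_cases hne : b = a
    · rwa [hne]
    obtain ⟨Q, d, hb, ha'⟩ := exists_branch hne
    rcases le_or_gt P.length Q.length with hl | hl
    · have := ha.prefix_of_length_le (ha'.mono (List.prefix_append _ _)) hl
      exact hb.mono (this.trans (List.prefix_append _ _))
    · exfalso
      have hc' : Pre c (Q ++ [!d]) :=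
        hc.mono (ha'.prefix_of_length_le ha (by simp; omega))
      have h1 := pre_T_branch hjk ha'
      have h2 := pre_T_branch hjk hb
      have h3 := pre_T_branch hjk hc'
      exact not_pre_branch h2 (h.convex hab hbc h1 h3)

theorem accPoint_T (hN : Normalized le) {j k : ℕ} (hjk : j < k) {x : W2}
    (hx : AccPoint (Dominant fun a b => le (T j k a) (T j k b)) x) :
    AccPoint (Dominant le) (T j k x) := by
  intro Q hQ
  obtain ⟨y, hy, hne, hP⟩ := hx (pfx x Q.length) (pre_pfx _ _)
  refine ⟨T j k y, dominant_T hN hy, (T_injective hjk).ne hne, (pre_T hP).mono ?_⟩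
  refine hQ.prefix_of_length_le (pre_T (pre_pfx _ _)) ?_
  have := length_le_length_ap j k (pfx x Q.length)
  rwa [length_pfx] at this

theorem exists_eq_T_of_dominant (h : ConvexOrder le) {j k c : ℕ} (hc : Up le c)
    (hjk : ∀ i ≤ c, Up le i → i = j ∨ i = k) {y : W2} (hy : Dominant le y)
    (hyc : Pre y (blk c)) : ∃ a, y = T j k a := by
  refine exists_eq_T (pre_cons.mp hyc).1.symm fun n hn => ?_
  obtain ⟨i, hi, hu, hp⟩ := h.exists_up_of_le hc hyc (by simpa [shiftn] using hn) (hy n)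
  rcases hjk i hi hu with rfl | rfl
  · exact Or.inl hp
  · exact Or.inr hp

/-- If there are no two blocks `10^j`, `10^k` below `10^∞`, then `10^∞` is the smallest
accumulation point. -/
theorem eq_w10inf_of_unique_up (h : ConvexOrder le) (hN : Normalized le) {m : W2}
    (hm : IsSmallestAccWord le m) (hu : ∀ i j, Up le i → Up le j → i = j) : m = w10inf := by
  have hle := hm.2 _ (h.accPoint_w10inf hN)
  rcases eq_w10inf_or_pre_blk (h.accPoint_zero hN hm.1) with hz | ⟨c, hc⟩
  · exact hz
  exfalso
  have hup : Up le c := ⟨m, hc, hle⟩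
  have huniq : ∀ i ≤ c, Up le i → i = c ∨ i = c := fun i _ hi => Or.inl (hu i c hi hup)
  obtain ⟨y, hy, hne, hyc⟩ := hm.1 _ hc
  obtain ⟨a, rfl⟩ := h.exists_eq_T_of_dominant hup huniq hy hyc
  obtain ⟨b, rfl⟩ := h.exists_eq_T_of_dominant hup huniq (h.dominant_of_accPoint hm.1) hc
  apply hne
  have hap : ∀ P Q : List Bool, P.length = Q.length → ap c c P = ap c c Q := by
    intro P Q
    induction P generalizing Q with
    | nil => intro hl; rw [List.length_eq_zero_iff.mp hl.symm]
    | cons p P ih =>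
      cases Q with
      | nil => simp
      | cons q Q =>
        intro hl
        rw [ap_cons, ap_cons, ih Q (by simpa using hl)]
        simp
  refine eq_T_of_pre fun P _ => ?_
  rw [hap P (pfx a P.length) (length_pfx _ _).symm]
  exact pre_T (pre_pfx _ _)

theorem exists_desubstitution (h : ConvexOrder le) (hN : Normalized le) {m : W2}
    (hm : IsSmallestAccWord le m) {j k : ℕ} (hjk : j < k) (hj : Up le j) (hk : Up le k)
    (hle : ∀ i ≤ k, Up le i → i = j ∨ i = k) :
    ∃ m', m = T j k m' ∧ Normalized (fun a b => le (T j k a) (T j k b)) ∧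
      IsSmallestAccWord (fun a b => le (T j k a) (T j k b)) m' := by
  have h' := h.induced hjk
  have hN' : Normalized (fun a b => le (T j k a) (T j k b)) := by
    intro a b ha hb
    have h1 : Pre a ([] ++ [false]) := pre_cons.mpr ⟨ha.symm, pre_nil _⟩
    have h2 : Pre b ([] ++ [true]) := pre_cons.mpr ⟨hb.symm, pre_nil _⟩
    have h3 := pre_T_branch hjk h1
    have h4 := pre_T_branch hjk h2
    rw [ap_nil, List.nil_append] at h3 h4
    exact h.le_w10inf_of_up hj h3 h4
  have hacc := accPoint_T hN hjk (h'.accPoint_w10inf hN')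
  have hTz : Pre (T j k w10inf) (blk k) := by
    refine (pre_T (pre_w10inf 1)).mono ?_
    simp [ap_cons, ap_nil]
  obtain ⟨c, hck, hc, hmc⟩ := h.exists_up_of_le hk hTz (h.accPoint_zero hN hm.1) (hm.2 _ hacc)
  have hblocks : ∀ i ≤ c, Up le i → i = j ∨ i = k := fun i hi => hle i (hi.trans hck)
  obtain ⟨m', rfl⟩ :=
    h.exists_eq_T_of_dominant hc hblocks (h.dominant_of_accPoint hm.1) hmc
  refine ⟨m', rfl, hN', ?_, fun y hy => hm.2 _ (accPoint_T hN hjk hy)⟩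
  intro P hP
  set Q := pfx (T j k m') ((ap j k P).length + k + j + 2)
  have hQl : Q.length = (ap j k P).length + k + j + 2 := length_pfx _ _
  obtain ⟨y, hy, hne, hyQ⟩ := hm.1 Q (pre_pfx _ _)
  have hyc : Pre y (blk c) :=
    hyQ.mono (hmc.prefix_of_length_le (pre_pfx _ _) (by rw [hQl]; simp; omega))
  obtain ⟨y', rfl⟩ := h.exists_eq_T_of_dominant hc hblocks hy hyc
  have hne' : y' ≠ m' := fun he => hne (congrArg _ he)
  refine ⟨y', fun i => ?_, hne', ?_⟩
  · have := shiftn_T (j := j) (k := k) (pre_pfx y' i)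
    rw [length_pfx] at this
    beta_reduce
    rw [← this]
    exact hy _
  · obtain ⟨R, d, hm1, hy1⟩ := exists_branch hne'.symm
    rcases le_or_gt P.length R.length with hl | hl
    · have := hP.prefix_of_length_le (hm1.mono (List.prefix_append _ _)) hl
      exact hy1.mono (this.trans (List.prefix_append _ _))
    · exfalso
      have hRP : R <+: P := (hm1.mono (List.prefix_append _ _)).prefix_of_length_le hP hl.le
      have hlen := (ap_isPrefix j k hRP).length_le
      have h1 := pre_T_branch hjk hm1
      have h2 := pre_T_branch hjk hy1
      refine not_pre_branch (hyQ.mono (h1.prefix_of_length_le (pre_pfx _ _) ?_)) h2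
      rw [hQl]; simp; omega

end ConvexOrder

/-- The class of smallest accumulation points for normalized cylinder orders. -/
def IsMinAccWord (m : W2) : Prop :=
  ∃ le, ConvexOrder le ∧ Normalized le ∧ IsSmallestAccWord le m

theorem IsMinAccWord.desubstitute (m : W2) (hm : IsMinAccWord m) :
    m = w10inf ∨ ∃ j k m', j < k ∧ IsMinAccWord m' ∧ m = T j k m' := by
  obtain ⟨le, h, hN, hm⟩ := hm
  by_cases hu : ∀ i j, Up le i → Up le j → i = j
  · exact Or.inl (h.eq_w10inf_of_unique_up hN hm hu)
  right
  have hex : ∃ k, Up le k ∧ ∃ j < k, Up le j := by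
    push Not at hu
    obtain ⟨i, j, hi, hj, hij⟩ := hu
    rcases lt_or_gt_of_ne hij with hlt | hlt
    · exact ⟨j, hj, i, hlt, hi⟩
    · exact ⟨i, hi, j, hlt, hj⟩
  have hmin := fun n => Nat.find_min hex (m := n)
  obtain ⟨hk, j, hjk, hj⟩ := Nat.find_spec hex
  set k := Nat.find hex
  have hle : ∀ i ≤ k, Up le i → i = j ∨ i = k := by
    intro i hi hui
    by_contra! hne
    rcases lt_or_gt_of_ne hne.1 with hlt | hlt
    · exact hmin j hjk ⟨hj, i, hlt, hui⟩
    · exact hmin i (lt_of_le_of_ne hi hne.2) ⟨hui, j, hlt, hj⟩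
  obtain ⟨m', hm', hN', hs⟩ := h.exists_desubstitution hN hm hjk hj hk hle
  exact ⟨j, k, m', hjk, ⟨_, h.induced hjk, hN', hs⟩, hm'⟩

/-! ### Exchange of letters -/

/-- Exchange of the letters `0` and `1`. -/
def flip (a : W2) : W2 := fun n => !a n

theorem flip_flip (a : W2) : flip (flip a) = a := by
  funext n; simp [flip]

theorem flip_injective : Function.Injective flip := fun a b h => by
  rw [← flip_flip a, h, flip_flip]

theorem Pre.flip {a : W2} {P : List Bool} (h : Pre a P) : Pre (flip a) (P.map not) := by
  intro i hi
  rw [List.getElem_map, h i (by simpa using hi)]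
  rfl

theorem pre_flip_iff {a : W2} {P : List Bool} : Pre (flip a) P ↔ Pre a (P.map not) := by
  constructor
  · intro h
    have := h.flip
    rwa [flip_flip] at this
  · intro h
    have := h.flip
    rwa [List.map_map, show not ∘ not = id by funext b; simp, List.map_id] at this

theorem ConvexOrder.flip {le : W2 → W2 → Prop} (h : ConvexOrder le) :
    ConvexOrder fun a b => le (flip a) (flip b) where
  total _ _ := h.total _ _
  antisymm _ _ h1 h2 := flip_injective (h.antisymm _ _ h1 h2)
  trans _ _ _ h1 h2 := h.trans _ _ _ h1 h2
  convex {a b c P} hab hbc ha hc := by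
    have := (h.convex hab hbc ha.flip hc.flip).flip
    rwa [flip_flip, List.map_map, show not ∘ not = id by funext b; simp, List.map_id] at this

theorem accPoint_flip {le : W2 → W2 → Prop} {x : W2} (hx : AccPoint (Dominant le) x) :
    AccPoint (Dominant fun a b => le (flip a) (flip b)) (flip x) := by
  intro P hP
  obtain ⟨y, hy, hne, hyP⟩ := hx _ (pre_flip_iff.mp hP)
  refine ⟨flip y, fun n => ?_, flip_injective.ne hne, pre_flip_iff.mpr hyP⟩
  have : flip (shiftn (flip y) n) = shiftn y n := by
    funext i; simp [flip, shiftn]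
  beta_reduce
  rw [this, flip_flip]
  exact hy n

theorem IsSmallestAccWord.flip {le : W2 → W2 → Prop} {m : W2} (hm : IsSmallestAccWord le m) :
    IsSmallestAccWord (fun a b => le (flip a) (flip b)) (flip m) := by
  refine ⟨accPoint_flip hm.1, fun y hy => ?_⟩
  beta_reduce
  rw [flip_flip]
  apply hm.2
  have := accPoint_flip hy
  simpa only [flip_flip] using this

theorem complexity_flip (m : W2) (n : ℕ) : complexity (flip m) n = complexity m n := by
  have : factorSet (flip m) n = List.map not '' factorSet m n := by
    ext l
    constructor
    · rintro ⟨k, rfl⟩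
      exact ⟨_, ⟨k, rfl⟩, by simp [List.map_ofFn, Function.comp_def, flip]⟩
    · rintro ⟨_, ⟨k, rfl⟩, rfl⟩
      exact ⟨k, by simp [List.map_ofFn, Function.comp_def, flip]⟩
  rw [complexity, this,
    Set.ncard_image_of_injective _ (List.map_injective_iff.mpr Bool.not_injective)]
  rfl

theorem ConvexOrder.normalized_or_flip {le : W2 → W2 → Prop} (h : ConvexOrder le) :
    Normalized le ∨ Normalized fun a b => le (CylinderOrder.flip a) (CylinderOrder.flip b) := by
  have hp : ∀ (a : W2) (c : Bool), a 0 = c → Pre a ([] ++ [c]) := fun a c hc =>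
    pre_cons.mpr ⟨hc.symm, pre_nil _⟩
  rcases h.total w0 w1 with h01 | h10
  · exact Or.inl fun a b ha hb => h.le_of_branch (P := []) (c := false) h01
      (hp _ _ rfl) (hp _ _ rfl) (hp _ _ ha) (hp _ _ hb)
  · exact Or.inr fun a b ha hb => h.le_of_branch (P := []) (c := true) h10
      (hp _ _ rfl) (hp _ _ rfl) (hp _ _ (by simp [CylinderOrder.flip, ha]))
      (hp _ _ (by simp [CylinderOrder.flip, hb]))

end CylinderOrder

open CylinderOrder

/-- For any cylinder order `≤` on `{0,1}^∞`,
the factor complexity of `m_≤` satisfies `p_{m_≤}(n) ≤ 3n - 2` for all `n ≥ 2`. -/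
theorem stmt_9 (le : W2 → W2 → Prop) (h : IsCylOrder le) (m : W2)
    (hm : IsSmallestAcc le (supWords le) m) :
    ∀ n : ℕ, 2 ≤ n → complexity m n ≤ 3 * n - 2 := by
  have hc := convexOrder_of_isCylOrder h
  have hdom : (fun y => y ∈ supWords le) = Dominant le :=
    funext fun y => propext hc.mem_supWords_iff
  have hs : IsSmallestAccWord le m := by
    refine ⟨hdom ▸ isAccPt'_iff.mp hm.1, fun y hy => hm.2 y (isAccPt'_iff.mpr (hdom ▸ hy))⟩
  intro n hn
  rcases hc.normalized_or_flip with hN | hN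
  · exact complexity_le IsMinAccWord.desubstitute ⟨le, hc, hN, hs⟩ n hn
  · rw [← complexity_flip]
    exact complexity_le IsMinAccWord.desubstitute ⟨_, hc.flip, hN, hs.flip⟩ n hn
end
end
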